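/- arXiv:2402.04428 — 3 statements merged into one kernel-verified Lean document; each statement's English description precedes it below -/
import Mathlib

section
/- Let c be a positive integer with c ≠ 3 and c ≠ 9. Then there is at most one triple (x,y,z) of positive integers with 7^x + 2^y = c^z. Moreover, the triples (x,y,z) of positive integers with 7^x + 2^y = 3^z are exactly (1,1,2) and (2,5,4). -/
/-- A positive definite binary quadratic form with even middle coefficient represents the first
coefficient of a reduced form of the same discriminant. -/
lemma exists_reduced_form {D : ℤ} (hD : 0 < D) (a b c : ℤ) (ha : 0 < a) (h : a * c - b ^ 2 = D) :
    ∃ x y j b' c' : ℤ, a * x ^ 2 + 2 * b * x * y + c * y ^ 2 = j ∧ 0 < j ∧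
      j * c' - b' ^ 2 = D ∧ 2 * |b'| ≤ j ∧ j ≤ c' := by
  induction hn : a.toNat using Nat.strong_induction_on generalizing a b c with
  | _ n ih =>
    obtain ⟨q, hq⟩ : ∃ q : ℤ, 2 * |b - q * a| ≤ a := by
      refine ⟨(2 * b + a) / (2 * a), ?_⟩
      have h1 := Int.mul_ediv_add_emod (2 * b + a) (2 * a)
      have h2 := Int.emod_nonneg (2 * b + a) (b := 2 * a) (by omega)
      have h3 := Int.emod_lt_of_pos (2 * b + a) (b := 2 * a) (by omega)
      have h4 : 2 * |b - (2 * b + a) / (2 * a) * a| =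
          |2 * (b - (2 * b + a) / (2 * a) * a)| := by rw [abs_mul]; norm_num
      rw [h4, abs_le]
      constructor <;> nlinarith
    have hdet : a * (a * q ^ 2 - 2 * b * q + c) - (b - q * a) ^ 2 = D := by
      rw [← h]; ring
    set c₁ := a * q ^ 2 - 2 * b * q + c with hc₁
    rcases le_or_gt a c₁ with hac | hac
    · exact ⟨1, 0, a, b - q * a, c₁, by ring, ha, hdet, hq, hac⟩
    · have hc₁pos : 0 < c₁ := by
        by_contra hcon
        have : a * c₁ ≤ 0 := mul_nonpos_of_nonneg_of_nonpos ha.le (not_lt.mp hcon)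
        nlinarith [sq_nonneg (b - q * a)]
      obtain ⟨x, y, j, b', c', h1, h2⟩ :=
        ih c₁.toNat (by omega) c₁ (b - q * a) a hc₁pos (by rw [← hdet]; ring) rfl
      exact ⟨y - q * x, x, j, b', c', by rw [← h1, hc₁]; ring, h2⟩

/-- A proper representation of a multiple of `N` by `P ^ 2 + D * Q ^ 2` yields a compatible
representation of a small multiple of `N`. -/
lemma exists_compatible_repr {D N P Q : ℤ} (hD : 0 < D) (hN : 0 < N)
    (hPQ : N ∣ P ^ 2 + D * Q ^ 2) (hQ : IsCoprime Q N) :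
    ∃ a b j b' c' : ℤ, a ^ 2 + D * b ^ 2 = j * N ∧ N ∣ a * Q - b * P ∧ N ∣ a * P + D * b * Q ∧
      0 < j ∧ j * c' - b' ^ 2 = D ∧ 2 * |b'| ≤ j ∧ j ≤ c' := by
  obtain ⟨u, v, huv⟩ := hQ
  obtain ⟨M₀, hM₀⟩ := hPQ
  have hM : N ∣ (u * P) ^ 2 + D := by
    refine ⟨u ^ 2 * M₀ + D * (1 + u * Q) * v, ?_⟩
    have : 1 - u * Q = v * N := by linarith
    linear_combination u ^ 2 * hM₀ + D * (1 + u * Q) * this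
  obtain ⟨M, hM⟩ := hM
  obtain ⟨e, b, j, b', c', h1, h2⟩ := exists_reduced_form hD N (u * P) M hN
    (by linear_combination -hM)
  refine ⟨u * P * b + N * e, b, j, b', c', ?_, ⟨e * Q - b * P * v, ?_⟩, ?_, h2⟩
  · linear_combination N * h1 + b ^ 2 * hM
  · linear_combination b * P * huv
  · refine ⟨b * u * M₀ + D * b * Q * v + e * P, ?_⟩
    linear_combination b * u * hM₀ - D * b * Q * huv

/-- If `N` divides `A * B`, where `A` is coprime to `A'` and `A * A' = N ^ k`, then `N ^ k` divides
`A * B ^ k`. -/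
lemma dvd_mul_pow_of_isCoprime {R : Type*} [CommRing R] {A A' B N : R} {k : ℕ} (hk : 2 ≤ k)
    (hcop : IsCoprime A A') (hA : A * A' = N ^ k) (h : N ∣ A * B) : N ^ k ∣ A * B ^ k := by
  obtain ⟨n, rfl⟩ : ∃ n, k = n + 2 := ⟨k - 2, by omega⟩
  have h1 : N ^ (n + 2) ∣ A ^ (n + 1) * (A * B ^ (n + 2)) := by
    have := pow_dvd_pow_of_dvd h (n + 2)
    convert this using 1
    ring
  have h2 : N ^ (n + 2) ∣ A' ^ (n + 1) * (A * B ^ (n + 2)) := by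
    rw [← hA]
    exact ⟨A' ^ n * B ^ (n + 2), by ring⟩
  obtain ⟨s, t, hst⟩ := hcop.pow (m := n + 1) (n := n + 1)
  have : A * B ^ (n + 2) = s * (A ^ (n + 1) * (A * B ^ (n + 2))) +
      t * (A' ^ (n + 1) * (A * B ^ (n + 2))) := by
    linear_combination -(A * B ^ (n + 2)) * hst
  rw [this]
  exact dvd_add (h1.mul_left _) (h2.mul_left _)

/-- The Lucas sequence of the first kind with parameters `P` and `Q`. -/
def lucasU (P Q : ℤ) : ℕ → ℤ
  | 0 => 0
  | 1 => 1
  | n + 2 => P * lucasU P Q (n + 1) - Q * lucasU P Q n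

lemma lucasU_add_two (P Q : ℤ) (n : ℕ) :
    lucasU P Q (n + 2) = P * lucasU P Q (n + 1) - Q * lucasU P Q n := rfl

lemma lucasU_two (P Q : ℤ) : lucasU P Q 2 = P := by
  simp [lucasU]

lemma lucasU_three (P Q : ℤ) : lucasU P Q 3 = P ^ 2 - Q := by
  simp only [lucasU]; ring

lemma lucasU_seven (P Q : ℤ) :
    lucasU P Q 7 = P ^ 6 - 5 * P ^ 4 * Q + 6 * P ^ 2 * Q ^ 2 - Q ^ 3 := by
  simp only [lucasU]; ring

lemma odd_lucasU {P Q : ℤ} (hP : Even P) (hQ : Odd Q) (n : ℕ) : Odd (lucasU P Q (2 * n + 1)) := by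
  induction n with
  | zero => exact odd_one
  | succ n ih =>
    have : 2 * (n + 1) + 1 = (2 * n + 1) + 2 := by ring
    rw [this, lucasU_add_two]
    exact (hP.mul_right _).sub_odd (hQ.mul ih)

/-- Modulo the discriminant the Lucas sequence behaves as in the case of a double root. -/
lemma dvd_lucasU_sub (u w : ℤ) (n : ℕ) :
    w ∣ lucasU (2 * u) (u ^ 2 + w) (n + 1) - (n + 1) * u ^ n := by
  induction n using Nat.twoStepInduction with
  | zero => simp [lucasU]
  | one => simp [lucasU]
  | more n h1 h2 =>
    obtain ⟨r, hr⟩ := h1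
    obtain ⟨s, hs⟩ := h2
    refine ⟨2 * u * s - (u ^ 2 + w) * r - (n + 1) * u ^ n, ?_⟩
    rw [lucasU_add_two]
    push_cast at hs ⊢
    linear_combination 2 * u * hs - (u ^ 2 + w) * hr

lemma Zsqrtd.pow_add_two {d : ℤ} (B : ℤ√d) (n : ℕ) :
    B ^ (n + 2) = (2 * B.re : ℤ) * B ^ (n + 1) - (B.norm : ℤ) * B ^ n := by
  have : B ^ 2 = (2 * B.re : ℤ) * B - (B.norm : ℤ) := by
    ext
    · simp [pow_two, Zsqrtd.norm_def]; ring
    · simp [pow_two, Zsqrtd.norm_def]; ring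
  linear_combination B ^ n * this

lemma Zsqrtd.im_pow {d : ℤ} (B : ℤ√d) (n : ℕ) :
    (B ^ n).im = B.im * lucasU (2 * B.re) B.norm n := by
  induction n using Nat.twoStepInduction with
  | zero => simp [lucasU]
  | one => simp [lucasU]
  | more n h1 h2 =>
    rw [Zsqrtd.pow_add_two, lucasU_add_two, Zsqrtd.im_sub, Zsqrtd.im_smul, Zsqrtd.im_smul, h1, h2]
    ring

lemma Zsqrtd.norm_pow {d : ℤ} (B : ℤ√d) (n : ℕ) : (B ^ n).norm = B.norm ^ n :=
  map_pow Zsqrtd.normMonoidHom B n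

lemma Zsqrtd.lucasU_mul {d : ℤ} (B : ℤ√d) (hB : B.im ≠ 0) (m n : ℕ) :
    lucasU (2 * B.re) B.norm (m * n) =
      lucasU (2 * B.re) B.norm m * lucasU (2 * (B ^ m).re) (B ^ m).norm n := by
  have h := Zsqrtd.im_pow B (m * n)
  rw [pow_mul, Zsqrtd.im_pow (B ^ m), Zsqrtd.im_pow B m, mul_assoc] at h
  exact (mul_left_cancel₀ hB h).symm

/-- A prime power dividing a term of a Lucas sequence whose discriminant is divisible by that prime
divides the index of the term. -/
lemma Zsqrtd.pow_dvd_of_pow_dvd_lucasU {d : ℤ} {p : ℕ} (hp : p.Prime)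
    (hlucas : ∀ R W : ℤ, (p : ℤ) ∣ W → ¬ (p : ℤ) ∣ R →
      ∃ r, lucasU (2 * R) (R ^ 2 + W) p = p * r ∧ ¬ (p : ℤ) ∣ r)
    (B : ℤ√d) (him : B.im ≠ 0) (hdvd : (p : ℤ) ∣ d * B.im ^ 2) (hre : ¬ (p : ℤ) ∣ B.re)
    (j K : ℕ) (h : (p : ℤ) ^ j ∣ lucasU (2 * B.re) B.norm K) : p ^ j ∣ K := by
  have hpz : Prime (p : ℤ) := Nat.prime_iff_prime_int.mp hp
  induction j generalizing K with
  | zero => simp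
  | succ j ih =>
    rcases K with _ | n
    · simp
    have hnorm : B.norm = B.re ^ 2 + -(d * B.im ^ 2) := by rw [Zsqrtd.norm_def]; ring
    have hK : p ∣ n + 1 := by
      have h1 := (dvd_neg.mpr hdvd).trans (dvd_lucasU_sub B.re (-(d * B.im ^ 2)) n)
      rw [← hnorm] at h1
      have h2 := (dvd_sub_right ((dvd_pow_self _ j.succ_ne_zero).trans h)).mp h1
      rcases hpz.dvd_or_dvd h2 with h3 | h3
      · exact_mod_cast h3
      · exact absurd (hpz.dvd_of_dvd_pow h3) hre
    obtain ⟨K', hK'⟩ := hK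
    rw [hK', mul_comm p K', Zsqrtd.lucasU_mul B him] at h
    have hW : (p : ℤ) ∣ -(d * (B ^ K').im ^ 2) := by
      rw [Zsqrtd.im_pow, dvd_neg]
      exact hdvd.trans ⟨lucasU (2 * B.re) B.norm K' ^ 2, by ring⟩
    have hnorm' : (B ^ K').norm = (B ^ K').re ^ 2 + -(d * (B ^ K').im ^ 2) := by
      rw [Zsqrtd.norm_def]; ring
    have hR : ¬ (p : ℤ) ∣ (B ^ K').re := by
      intro hcon
      have h1 : (p : ℤ) ∣ B.norm ^ K' := by
        rw [← Zsqrtd.norm_pow, hnorm']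
        exact dvd_add (dvd_pow hcon two_ne_zero) hW
      have h2 := hpz.dvd_of_dvd_pow h1
      rw [hnorm] at h2
      exact hre (hpz.dvd_of_dvd_pow ((dvd_add_left (dvd_neg.mpr hdvd)).mp h2))
    obtain ⟨r, hr, hpr⟩ := hlucas _ _ hW hR
    rw [hnorm', hr] at h
    rw [hK', pow_succ']
    refine mul_dvd_mul_left p (ih K' ?_)
    have h3 : (p : ℤ) ^ j ∣ lucasU (2 * B.re) B.norm K' * r := by
      have : (p : ℤ) * p ^ j ∣ p * (lucasU (2 * B.re) B.norm K' * r) := by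
        convert h using 1 <;> ring
      exact (mul_dvd_mul_iff_left hpz.ne_zero).mp this
    exact hpz.pow_dvd_of_dvd_mul_right j hpr h3

lemma exists_lucasU_two_eq (R W : ℤ) (_ : ((2 : ℕ) : ℤ) ∣ W) (hR : ¬ ((2 : ℕ) : ℤ) ∣ R) :
    ∃ r, lucasU (2 * R) (R ^ 2 + W) 2 = (2 : ℕ) * r ∧ ¬ ((2 : ℕ) : ℤ) ∣ r :=
  ⟨R, by rw [lucasU_two]; simp, hR⟩

lemma exists_lucasU_seven_eq (R W : ℤ) (hW : ((7 : ℕ) : ℤ) ∣ W) (hR : ¬ ((7 : ℕ) : ℤ) ∣ R) :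
    ∃ r, lucasU (2 * R) (R ^ 2 + W) 7 = (7 : ℕ) * r ∧ ¬ ((7 : ℕ) : ℤ) ∣ r := by
  have h7 : Prime ((7 : ℕ) : ℤ) := Nat.prime_iff_prime_int.mp (by norm_num)
  obtain ⟨V, rfl⟩ := hW
  refine ⟨R ^ 6 + 7 * (-5 * R ^ 4 * V + 21 * R ^ 2 * V ^ 2 - 7 * V ^ 3), ?_, fun h => hR ?_⟩
  · rw [lucasU_seven]; push_cast; ring
  · exact h7.dvd_of_dvd_pow ((dvd_add_left (Dvd.intro _ rfl)).mp h)

lemma sq_add_fourteen_mul_sq_ne (n : ℕ) (e f : ℤ) : e ^ 2 + 14 * f ^ 2 ≠ 2 ^ (2 * n + 1) := by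
  induction n generalizing e f with
  | zero =>
    intro h
    simp only [mul_zero, zero_add, pow_one] at h
    have hf : f = 0 := by
      by_contra hf
      have : 0 < f ^ 2 := by positivity
      nlinarith [sq_nonneg e]
    subst hf
    have h1 : e < 2 := by nlinarith
    have h2 : -2 < e := by nlinarith
    interval_cases e <;> simp at h
  | succ n ih =>
    intro h
    have h' : e ^ 2 + 14 * f ^ 2 = 4 * (2 * 2 ^ (2 * n)) := by rw [h]; ring
    have he : Even e := by
      have : Even (e ^ 2) := ⟨2 * (2 * 2 ^ (2 * n)) - 7 * f ^ 2, by linarith⟩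
      exact (Int.even_pow.mp this).1
    obtain ⟨e, rfl⟩ := he
    have hf : Even f := by
      have : Even (7 * f ^ 2) := ⟨(2 * 2 ^ (2 * n)) - e ^ 2, by linarith⟩
      rcases Int.even_mul.mp this with h7 | h7
      · exact absurd h7 (by decide)
      · exact (Int.even_pow.mp h7).1
    obtain ⟨f, rfl⟩ := hf
    apply ih e f
    have h2 : (2 : ℤ) ^ (2 * n + 1) = 2 * 2 ^ (2 * n) := by ring
    rw [h2]
    linarith

lemma eq_one_or_two_of_reduced {D C a b j b' c' : ℤ} (hD : D = 2 ∨ D = 4 ∨ D = 7 ∨ D = 14)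
    (hC : Odd C) (hC7 : ¬ 7 ∣ C) (hab : a ^ 2 + D * b ^ 2 = j * C ^ 2) (hj : 0 < j)
    (hdet : j * c' - b' ^ 2 = D) (hb : 2 * |b'| ≤ j) (hc : j ≤ c') :
    j = 1 ∨ (D = 14 ∧ j = 2) := by
  have hb1 : 4 * b' ^ 2 ≤ j ^ 2 := by
    rw [← sq_abs b']
    nlinarith [abs_nonneg b']
  have hj3 : 3 * j ^ 2 ≤ 4 * D := by
    have : j * j ≤ j * c' := mul_le_mul_of_nonneg_left hc hj.le
    linarith [pow_two j]
  have hj5 : j < 5 := by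
    by_contra! hcon
    have : 5 * 5 ≤ j * j := mul_le_mul hcon hcon (by norm_num) hj.le
    have : D ≤ 14 := by omega
    linarith [pow_two j]
  have hb2 : -2 ≤ b' ∧ b' ≤ 2 := abs_le.mp (by omega)
  have hC8 : C ^ 2 % 8 = 1 := by have := Int.eight_dvd_sq_sub_one_of_odd hC; omega
  have ha8 : a ^ 2 % 8 = 0 ∨ a ^ 2 % 8 = 1 ∨ a ^ 2 % 8 = 4 := by
    have : a % 8 = 0 ∨ a % 8 = 1 ∨ a % 8 = 2 ∨ a % 8 = 3 ∨ a % 8 = 4 ∨ a % 8 = 5 ∨ a % 8 = 6 ∨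
      a % 8 = 7 := by omega
    rcases this with h | h | h | h | h | h | h | h <;> simp [pow_two, Int.mul_emod, h]
  have hb8 : b ^ 2 % 8 = 0 ∨ b ^ 2 % 8 = 1 ∨ b ^ 2 % 8 = 4 := by
    have : b % 8 = 0 ∨ b % 8 = 1 ∨ b % 8 = 2 ∨ b % 8 = 3 ∨ b % 8 = 4 ∨ b % 8 = 5 ∨ b % 8 = 6 ∨
      b % 8 = 7 := by omega
    rcases this with h | h | h | h | h | h | h | h <;> simp [pow_two, Int.mul_emod, h]
  have ha7 : a ^ 2 % 7 = 0 ∨ a ^ 2 % 7 = 1 ∨ a ^ 2 % 7 = 2 ∨ a ^ 2 % 7 = 4 := by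
    have : a % 7 = 0 ∨ a % 7 = 1 ∨ a % 7 = 2 ∨ a % 7 = 3 ∨ a % 7 = 4 ∨ a % 7 = 5 ∨ a % 7 = 6 := by
      omega
    rcases this with h | h | h | h | h | h | h <;> simp [pow_two, Int.mul_emod, h]
  have hC7' : C ^ 2 % 7 = 1 ∨ C ^ 2 % 7 = 2 ∨ C ^ 2 % 7 = 4 := by
    have : C % 7 = 1 ∨ C % 7 = 2 ∨ C % 7 = 3 ∨ C % 7 = 4 ∨ C % 7 = 5 ∨ C % 7 = 6 := by omega
    rcases this with h | h | h | h | h | h <;> simp [pow_two, Int.mul_emod, h]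
  have hb'4 : b' ^ 2 = 0 ∨ b' ^ 2 = 1 ∨ b' ^ 2 = 4 := by
    obtain ⟨h1, h2⟩ := hb2
    interval_cases b' <;> simp
  generalize b' ^ 2 = b'' at *
  generalize a ^ 2 = a'' at *
  generalize b ^ 2 = b₂ at *
  generalize C ^ 2 = C₂ at *
  rcases hD with rfl | rfl | rfl | rfl
  · clear ha8 hb8 ha7 hC7' hb'4 hC8
    interval_cases j <;> omega
  · clear ha7 hC7' hb'4
    interval_cases j <;> omega
  · clear ha7 hC7'
    interval_cases j <;> omega
  · clear ha8 hb8 hC8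
    interval_cases j <;> omega

/-- For `D ∈ {2, 4, 7, 14}`, a primitive element of `ℤ√(-D)` whose norm is the `k`-th power of a
square prime to `14`, with `k` odd, is up to sign the `k`-th power of an element. -/
lemma Zsqrtd.eq_or_eq_neg_pow_of_norm_eq {D C : ℤ} {k : ℕ}
    (hD : D = 2 ∨ D = 4 ∨ D = 7 ∨ D = 14) (hC0 : 0 < C) (hC : Odd C) (hC7 : ¬ 7 ∣ C)
    (hk : Odd k) (hk2 : 2 ≤ k) (A : ℤ√(-D)) (hA : A.norm = (C ^ 2) ^ k)
    (hre : IsCoprime (2 * A.re) C) (him : IsCoprime A.im C) :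
    ∃ B : ℤ√(-D), B.norm = C ^ 2 ∧ (A = B ^ k ∨ A = -B ^ k) := by
  have hD0 : 0 < D := by omega
  have hnorm : ∀ Z : ℤ√(-D), Z.norm = Z.re ^ 2 + D * Z.im ^ 2 := fun Z => by
    rw [Zsqrtd.norm_def]; ring
  obtain ⟨a, b, j, b', c', hab, h1, h2, hj, hdet, hb, hc⟩ :=
    exists_compatible_repr (N := C ^ 2) (P := A.re) (Q := A.im) hD0 (by positivity)
      (by rw [← hnorm, hA]; exact dvd_pow_self _ (by omega)) him.pow_right
  set B : ℤ√(-D) := ⟨a, b⟩ with hBdef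
  have hBn : B.norm = j * C ^ 2 := by rw [hnorm, ← hab]
  have hcop : IsCoprime A (star A) := by
    obtain ⟨s, t, hst⟩ := hre.pow_right (n := 2 * k)
    have h3 : ((2 * A.re : ℤ) : ℤ√(-D)) = A + star A := by
      ext <;> simp [two_mul]
    have h4 : (((C ^ 2) ^ k : ℤ) : ℤ√(-D)) = A * star A := by
      rw [← hA, Zsqrtd.norm_eq_mul_conj]
    have h5 : (s : ℤ√(-D)) * (A + star A) + t * (A * star A) = 1 := by
      rw [← h3, ← h4, ← pow_mul]
      exact_mod_cast hst
    exact ⟨s, s + t * A, by linear_combination h5⟩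
  have hdvd : ((C ^ 2 : ℤ) : ℤ√(-D)) ∣ A * star B := by
    rw [Zsqrtd.intCast_dvd]
    constructor
    · convert h2 using 1
      simp [hBdef]; ring
    · convert h1 using 1
      simp [hBdef]; ring
  have hpow := dvd_mul_pow_of_isCoprime hk2 hcop
    (by rw [← Zsqrtd.norm_eq_mul_conj, hA]; push_cast; rfl) hdvd
  obtain ⟨E, hE⟩ := hpow
  have hE' : A * star B ^ k = (((C ^ 2) ^ k : ℤ) : ℤ√(-D)) * E := by
    rw [hE]; push_cast; rfl
  have hEn : E.norm = j ^ k := by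
    have h3 := congrArg Zsqrtd.norm hE'
    rw [Zsqrtd.norm_mul, Zsqrtd.norm_mul, Zsqrtd.norm_pow, Zsqrtd.norm_conj, hBn, hA,
      Zsqrtd.norm_intCast, mul_pow] at h3
    have h4 : ((C ^ 2) ^ k) * ((C ^ 2) ^ k) ≠ 0 := by positivity
    apply mul_left_cancel₀ h4
    rw [← h3]; ring
  rcases eq_one_or_two_of_reduced hD hC hC7 hab hj hdet hb hc with rfl | ⟨rfl, rfl⟩
  · refine ⟨B, by rw [hBn, one_mul], ?_⟩
    have hAE : A = E * B ^ k := by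
      have h3 : (((C ^ 2) ^ k : ℤ) : ℤ√(-D)) = star B ^ k * B ^ k := by
        rw [← mul_pow, mul_comm (star B), ← Zsqrtd.norm_eq_mul_conj, hBn]
        push_cast; ring
      have h4 : (((C ^ 2) ^ k : ℤ) : ℤ√(-D)) * A = (((C ^ 2) ^ k : ℤ) : ℤ√(-D)) * (E * B ^ k) := by
        rw [← mul_assoc, ← hE', h3]; ring
      exact Zsqrtd.eq_of_smul_eq_smul_left (by positivity) h4
    rw [hnorm, one_pow] at hEn
    have him0 : E.im = 0 := by
      by_contra hne
      have : 0 < E.im ^ 2 := by positivity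
      nlinarith [sq_nonneg E.re, show 2 ≤ D by omega]
    rw [him0] at hEn
    have hre1 : E.re = 1 ∨ E.re = -1 := sq_eq_one_iff.mp (by linarith)
    rcases hre1 with h | h
    · left
      have : E = 1 := by ext <;> simp [h, him0]
      rw [hAE, this, one_mul]
    · right
      have : E = -1 := by ext <;> simp [h, him0]
      rw [hAE, this, neg_one_mul]
  · obtain ⟨n, rfl⟩ := hk
    exact absurd ((hnorm E).symm.trans hEn) (sq_add_fourteen_mul_sq_ne n _ _)

lemma exists_sq_decomposition (x y : ℕ) (hy : 0 < y) :
    ∃ (D U V t : ℤ) (m : ℕ), (D = 2 ∨ D = 4 ∨ D = 7 ∨ D = 14) ∧ D = U * V ∧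
      7 ^ x = U * (7 ^ m) ^ 2 ∧ 2 ^ y = V * t ^ 2 ∧ 0 < t ∧ (7 ∣ D ∨ U = 1) := by
  rcases Nat.even_or_odd' x with ⟨m, rfl | rfl⟩ <;> rcases Nat.even_or_odd' y with ⟨n, rfl | rfl⟩
  · refine ⟨4, 1, 4, 2 ^ (n - 1), m, by simp, by simp, by ring, ?_, by positivity, by simp⟩
    obtain ⟨n, rfl⟩ : ∃ n', n = n' + 1 := ⟨n - 1, by omega⟩
    simp only [Nat.add_sub_cancel]
    ring
  · exact ⟨2, 1, 2, 2 ^ n, m, by simp, by simp, by ring, by ring, by positivity, by simp⟩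
  · exact ⟨7, 7, 1, 2 ^ n, m, by simp, by simp, by ring, by ring, by positivity, by simp⟩
  · exact ⟨14, 7, 2, 2 ^ n, m, by simp, by simp, by ring, by ring, by positivity, by norm_num⟩

lemma Int.natAbs_eq_seven_pow_of_dvd {S : ℤ} {n : ℕ} (h : S ∣ 7 ^ n) : ∃ i, S.natAbs = 7 ^ i := by
  have : S.natAbs ∣ 7 ^ n := by
    have := Int.natAbs_dvd_natAbs.mpr h
    simpa [Int.natAbs_pow] using this
  obtain ⟨i, _, hi⟩ := (Nat.dvd_prime_pow (by norm_num)).mp this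
  exact ⟨i, hi⟩

lemma three_mul_two_pow_sub_one_not_dvd (y n : ℕ) : ¬ (3 * 2 ^ y - 1 : ℤ) ∣ 7 ^ n := by
  intro h
  obtain ⟨i, hi⟩ := Int.natAbs_eq_seven_pow_of_dvd h
  have h1 : (3 * 2 ^ y - 1 : ℤ) = 7 ^ i := by
    have h2 : (0 : ℤ) ≤ 3 * 2 ^ y - 1 := by
      have : (1 : ℤ) ≤ 2 ^ y := one_le_pow₀ (by norm_num)
      linarith
    rw [← Int.natAbs_of_nonneg h2, hi]
    push_cast
    rfl
  have h3 : (7 : ℤ) ^ i % 3 = 1 := by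
    have := (show (7 : ℤ) ≡ 1 [ZMOD 3] by decide).pow i
    rw [one_pow] at this
    exact this
  omega

lemma eq_two_pow_add_one_of_sq_add {C u : ℤ} {y : ℕ} (hC0 : 0 < C) (hC : Odd C)
    (h : u ^ 2 + 4 * 2 ^ y = C ^ 2) : C = 2 ^ y + 1 ∧ u ^ 2 = (2 ^ y - 1) ^ 2 := by
  wlog hu : 0 ≤ u generalizing u
  · have := this (u := -u) (by rw [neg_sq, h]) (by omega)
    rwa [neg_sq] at this
  have hu' : Odd u := by
    have h1 : Odd (u ^ 2) := by
      have h2 : Odd (C ^ 2) := hC.pow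
      rw [← h] at h2
      have h3 : Even (4 * 2 ^ y : ℤ) := (show Even (4 : ℤ) by decide).mul_right _
      by_contra hcon
      exact (Int.not_odd_iff_even.mpr ((Int.not_odd_iff_even.mp hcon).add h3)) h2
    exact (Int.odd_pow' two_ne_zero).mp h1
  obtain ⟨p, hp⟩ := hC.sub_odd hu'
  obtain ⟨q, hq⟩ := hC.add_odd hu'
  have hpq : p * q = 2 ^ y := by
    have : (p + p) * (q + q) = 4 * 2 ^ y := by rw [← hp, ← hq]; linear_combination -h
    linarith
  have hCpq : C = p + q := by linarith
  have hle : p ≤ q := by linarith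
  have hY : (0 : ℤ) < 2 ^ y := by positivity
  have hq0 : 0 < q := by linarith
  have hp0 : 0 < p := by
    by_contra hcon
    nlinarith
  have key : ∀ r : ℤ, Odd r → r ∣ 2 ^ y → 0 < r → r = 1 := by
    intro r hr hdvd hr0
    have h1 : IsCoprime r (2 ^ y) := (Int.isCoprime_two_left.mpr hr).symm.pow_right
    have := h1.isUnit_of_dvd' dvd_rfl hdvd
    rcases Int.isUnit_iff.mp this with h | h <;> omega
  have hp1 : p = 1 := by
    rcases Int.even_or_odd p with hpe | hpo
    · have hqo : Odd q := by
        rcases Int.even_or_odd q with hqe | hqo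
        · rw [hCpq] at hC
          exact absurd (hpe.add hqe) (Int.not_even_iff_odd.mpr hC)
        · exact hqo
      have := key q hqo ⟨p, by linarith⟩ hq0
      omega
    · exact key p hpo ⟨q, hpq.symm⟩ hp0
  subst hp1
  have : q = 2 ^ y := by linarith
  have hu2 : u = 2 ^ y - 1 := by linarith
  exact ⟨by linarith, by rw [hu2]⟩

lemma three_dvd_of_seven_dvd {k y : ℕ} (hk : Odd k) (h : (7 : ℤ) ∣ (2 ^ y + 1) ^ k - 2 ^ y) :
    3 ∣ k := by
  have h1 : ((2 : ZMod 7) ^ y + 1) ^ k = 2 ^ y := by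
    have := (ZMod.intCast_zmod_eq_zero_iff_dvd _ 7).mpr (by exact_mod_cast h)
    push_cast at this
    exact sub_eq_zero.mp this
  have h6 : ∀ a : ZMod 7, a ≠ 0 → a ^ k = a ^ (k % 6) := by
    intro a ha
    have : a ^ 6 = 1 := by revert a; decide
    conv_lhs => rw [← Nat.div_add_mod k 6, pow_add, pow_mul, this, one_pow, one_mul]
  have h3 : (2 : ZMod 7) ^ y = 2 ^ (y % 3) := by
    have : (2 : ZMod 7) ^ 3 = 1 := by decide
    conv_lhs => rw [← Nat.div_add_mod y 3, pow_add, pow_mul, this, one_pow, one_mul]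
  have hk6 : k % 6 = 1 ∨ k % 6 = 3 ∨ k % 6 = 5 := by
    have := Nat.odd_iff.mp hk
    omega
  have hy3 : y % 3 = 0 ∨ y % 3 = 1 ∨ y % 3 = 2 := by omega
  rw [h3] at h1
  rcases hy3 with hy | hy | hy <;> rw [hy] at h1 <;> rw [h6 _ (by decide)] at h1 <;>
    rcases hk6 with hk' | hk' | hk' <;> rw [hk'] at h1 <;>
    first | omega | exact absurd h1 (by decide)

/-- A sum of a power of `7` and a power of `2`, with positive exponents, is not a `k`-th power for
an odd prime `k`. -/
lemma seven_pow_add_two_pow_ne_prime_pow {x y k : ℕ} {C : ℤ} (hx : 0 < x) (hy : 0 < y)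
    (hC0 : 0 < C) (hk : k.Prime) (hk2 : k ≠ 2) : 7 ^ x + 2 ^ y ≠ C ^ k := by
  intro h
  have hkodd : Odd k := hk.odd_of_ne_two hk2
  have hk3 : 3 ≤ k := by have := hk.two_le; omega
  have h2 : Prime (2 : ℤ) := Int.prime_two
  have h7 : Prime (7 : ℤ) := Nat.prime_iff_prime_int.mp (by norm_num)
  have hx7 : (7 : ℤ) ∣ 7 ^ x := dvd_pow_self _ hx.ne'
  have hCodd : Odd C := by
    have h1 : Odd (C ^ k) := by
      rw [← h]
      exact Odd.add_even (Odd.pow (by decide)) (Int.even_pow.mpr ⟨by decide, hy.ne'⟩)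
    exact (Int.odd_pow' hk.ne_zero).mp h1
  have hC7 : ¬ 7 ∣ C := by
    intro hcon
    have h1 : (7 : ℤ) ∣ 2 ^ y := by
      rw [← Int.dvd_add_right hx7, h]
      exact dvd_pow hcon hk.ne_zero
    exact absurd (h7.dvd_of_dvd_pow h1) (by decide)
  have hcop2 : IsCoprime 2 C := Int.isCoprime_two_left.mpr hCodd
  have hcop7 : IsCoprime 7 C := h7.coprime_iff_not_dvd.mpr hC7
  obtain ⟨D, U, V, t, m, hD, hUV, hU, hV, ht, hDU⟩ := exists_sq_decomposition x y hy
  have hD0 : 0 < D := by omega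
  set A : ℤ√(-D) := ⟨7 ^ x - 2 ^ y, 2 * (7 ^ m * t)⟩ with hAdef
  have hXY : D * (7 ^ m * t) ^ 2 = 7 ^ x * 2 ^ y := by rw [hU, hV, hUV]; ring
  have hA : A.norm = (C ^ 2) ^ k := by
    rw [← pow_mul, mul_comm, pow_mul, ← h, Zsqrtd.norm_def]
    linear_combination 4 * hXY
  have htC : IsCoprime t C :=
    (hcop2.pow_left (m := y)).of_isCoprime_of_dvd_left ⟨V * t, by rw [hV]; ring⟩
  obtain ⟨B, hBn, hAB⟩ := Zsqrtd.eq_or_eq_neg_pow_of_norm_eq hD hC0 hCodd hC7 hkodd hk.two_le A hA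
    (by
      have h1 : IsCoprime (2 * 2 * 7 ^ x + C * (-2 * C ^ (k - 1))) C :=
        ((hcop2.mul_left hcop2).mul_left hcop7.pow_left).add_mul_left_left _
      convert h1 using 1
      have h3 : C * C ^ (k - 1) = C ^ k := by rw [← pow_succ']; congr 1; omega
      simp only [hAdef]
      linear_combination 2 * h3 - 2 * h)
    (hcop2.mul_left (hcop7.pow_left.mul_left htC))
  set S := lucasU (2 * B.re) B.norm k with hS
  have hSodd : Odd S := by
    obtain ⟨n, rfl⟩ := hkodd
    exact odd_lucasU (even_two_mul _) (by rw [hBn]; exact hCodd.pow) n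
  have hsq : 4 * (7 ^ m * t) ^ 2 = B.im ^ 2 * S ^ 2 := by
    have h1 : A.im ^ 2 = (B ^ k).im ^ 2 := by
      rcases hAB with h1 | h1 <;> rw [h1]
      rw [Zsqrtd.im_neg, neg_sq]
    rw [Zsqrtd.im_pow] at h1
    simp only [hAdef] at h1
    linear_combination h1
  have hv : B.im ≠ 0 := by
    intro hcon
    rw [hcon] at hsq
    have : 0 < 4 * ((7 : ℤ) ^ m * t) ^ 2 := by positivity
    simp only [ne_eq, OfNat.ofNat_ne_zero, not_false_eq_true, zero_pow, zero_mul] at hsq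
    omega
  have hw : B.re ^ 2 + D * B.im ^ 2 = C ^ 2 := by
    rw [← hBn, Zsqrtd.norm_def]; ring
  have hprod : 4 * (7 ^ x * 2 ^ y) = D * B.im ^ 2 * S ^ 2 := by
    rw [← hXY]; linear_combination D * hsq
  have hS2cop : IsCoprime S 2 := (Int.isCoprime_two_left.mpr hSodd).symm
  have hSdvd : S ^ 2 ∣ 7 ^ x := by
    have h1 : S ^ 2 ∣ 7 ^ x * 2 ^ (y + 2) := ⟨D * B.im ^ 2, by linear_combination hprod⟩
    exact (hS2cop.pow (m := 2) (n := y + 2)).dvd_of_dvd_mul_right h1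
  by_cases hw7 : (7 : ℤ) ∣ D * B.im ^ 2
  · have hu7 : ¬ (7 : ℤ) ∣ B.re := by
      intro hcon
      refine hC7 (h7.dvd_of_dvd_pow (n := 2) ?_)
      rw [← hw]
      exact dvd_add (dvd_pow hcon two_ne_zero) hw7
    have hval : ∀ j, (7 : ℤ) ^ j ∣ S → 7 ^ j ∣ k := fun j hj =>
      Zsqrtd.pow_dvd_of_pow_dvd_lucasU (p := 7) (by norm_num) exists_lucasU_seven_eq B hv
        (by rw [neg_mul, dvd_neg]; exact_mod_cast hw7) (by exact_mod_cast hu7) j k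
        (by exact_mod_cast hj)
    obtain ⟨i, hi⟩ := Int.natAbs_eq_seven_pow_of_dvd ((dvd_pow_self S two_ne_zero).trans hSdvd)
    have hiS : (7 : ℤ) ^ i ∣ S := by
      rw [← Int.dvd_natAbs, hi]; push_cast; rfl
    have hik := hval i hiS
    have hS2 : S ^ 2 = (7 ^ i) ^ 2 := by
      rw [← Int.natAbs_sq, hi]; push_cast; rfl
    have hC3 : 3 ≤ C := by
      have : C ≠ 1 := by
        rintro rfl
        rw [one_pow] at h
        have h3 : (0 : ℤ) < 7 ^ x := by positivity
        have h4 : (1 : ℤ) < 2 ^ y := one_lt_pow₀ (by norm_num) hy.ne'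
        omega
      obtain ⟨r, rfl⟩ := hCodd
      omega
    have hmain : 4 * C ^ k ≤ 4 + C ^ 2 * S ^ 2 := by
      have h3 : (1 : ℤ) ≤ 7 ^ x := one_le_pow₀ (by norm_num)
      have h4 : (1 : ℤ) ≤ 2 ^ y := one_le_pow₀ (by norm_num)
      have h5 : D * B.im ^ 2 * S ^ 2 ≤ C ^ 2 * S ^ 2 :=
        mul_le_mul_of_nonneg_right (by nlinarith [sq_nonneg B.re]) (sq_nonneg _)
      rw [← h]
      nlinarith [mul_nonneg (sub_nonneg.mpr h3) (sub_nonneg.mpr h4)]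
    have hi' : (i = 0 ∧ 3 ≤ k) ∨ (i = 1 ∧ k = 7) := by
      rcases (Nat.dvd_prime hk).mp hik with h1 | h1
      · left
        exact ⟨by simpa using h1, hk3⟩
      · right
        have h3 : i ≠ 0 := by rintro rfl; rw [pow_zero] at h1; exact hk.one_lt.ne h1
        have h4 := (Nat.prime_dvd_prime_iff_eq (by norm_num : Nat.Prime 7) hk).mp
          ((dvd_pow_self 7 h3).trans hik)
        refine ⟨?_, h4.symm⟩
        rw [← h4] at h1
        exact Nat.pow_right_injective (by norm_num : 2 ≤ 7) (by simpa using h1)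
    rcases hi' with ⟨rfl, _⟩ | ⟨rfl, rfl⟩
    · rw [hS2] at hmain
      have : C ^ 3 ≤ C ^ k := pow_le_pow_right₀ (by omega) hk3
      nlinarith
    · rw [hS2] at hmain
      have h3 : C ^ 2 * 3 ^ 5 ≤ C ^ 2 * C ^ 5 :=
        mul_le_mul_of_nonneg_left (pow_le_pow_left₀ (by norm_num) hC3 5) (sq_nonneg _)
      nlinarith
  · have hD7 : ¬ (7 : ℤ) ∣ D := fun hcon => hw7 (hcon.mul_right _)
    have hU1 : U = 1 := hDU.resolve_left hD7
    have hv7 : ¬ (7 : ℤ) ∣ B.im := fun hcon => hw7 ((dvd_pow hcon two_ne_zero).mul_left _)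
    rw [hU1, one_mul] at hU hUV
    have hS2 : S ^ 2 = 7 ^ x := by
      refine Int.dvd_antisymm (sq_nonneg _) (by positivity) hSdvd ?_
      have h1 : (7 : ℤ) ^ x ∣ B.im ^ 2 * S ^ 2 := ⟨4 * t ^ 2, by rw [← hsq, hU]; ring⟩
      exact ((h7.coprime_iff_not_dvd.mpr hv7).pow (m := x) (n := 2)).dvd_of_dvd_mul_left h1
    have hw' : D * B.im ^ 2 = 4 * 2 ^ y := by
      have h1 : (7 : ℤ) ^ x ≠ 0 := by positivity
      apply mul_right_cancel₀ h1
      rw [hS2] at hprod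
      linear_combination -hprod
    rw [hw'] at hw
    obtain ⟨hC', hu⟩ := eq_two_pow_add_one_of_sq_add hC0 hCodd hw
    have hk3' : k = 3 := by
      have := three_dvd_of_seven_dvd hkodd (y := y) (by
        rw [← hC', ← h, add_sub_cancel_right]; exact hx7)
      exact ((Nat.prime_dvd_prime_iff_eq (by norm_num) hk).mp this).symm
    apply three_mul_two_pow_sub_one_not_dvd y x
    rw [← hS2, hS, hk3', lucasU_three, hBn, hC']
    exact Dvd.dvd.pow ⟨2 ^ y - 3, by linear_combination 4 * hu⟩ two_ne_zero

/-- In a solution of `w ^ 2 - 7 * s ^ 2 = 2`, divisibility of `s` by `7` forces divisibility by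
`617`. The proof descends along the orbit of `(3, 1)` modulo `4319 = 7 * 617`. -/
lemma dvd_of_seven_dvd_of_sq_sub {w s : ℤ} (hw : 0 < w) (hs : 0 < s) (h : w ^ 2 - 7 * s ^ 2 = 2)
    (h7 : 7 ∣ s) : 617 ∣ s := by
  suffices H : ∀ (n : ℕ) (w s : ℤ), s.toNat = n → 0 < w → 0 < s → w ^ 2 - 7 * s ^ 2 = 2 →
      (w % 4319 = 3 ∧ s % 4319 = 1) ∨ (w % 4319 = 45 ∧ s % 4319 = 17) ∨
      (w % 4319 = 717 ∧ s % 4319 = 271) ∨ (w % 4319 = 2789 ∧ s % 4319 = 0) ∨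
      (w % 4319 = 717 ∧ s % 4319 = 4048) ∨ (w % 4319 = 45 ∧ s % 4319 = 4302) ∨
      (w % 4319 = 3 ∧ s % 4319 = 4318) by
    have h1 := H s.toNat w s rfl hw hs h
    omega
  intro n
  induction n using Nat.strong_induction_on with
  | _ n ih =>
    intro w s hn hw hs h
    rcases lt_or_ge s 5 with hs5 | hs5
    · have hw11 : w < 11 := by nlinarith
      interval_cases s <;> interval_cases w <;> simp at h ⊢
    · have hw' : 0 < 8 * w - 21 * s := by nlinarith
      have hs' : 0 < 8 * s - 3 * w := by nlinarith
      have hlt : 8 * s - 3 * w < s := by nlinarith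
      have h1 := ih (8 * s - 3 * w).toNat (by omega) (8 * w - 21 * s) (8 * s - 3 * w) rfl hw' hs'
        (by linear_combination h)
      have e1 : w % 4319 =
          (8 * ((8 * w - 21 * s) % 4319) + 21 * ((8 * s - 3 * w) % 4319)) % 4319 := by
        clear h1 ih h
        omega
      have e2 : s % 4319 =
          (3 * ((8 * w - 21 * s) % 4319) + 8 * ((8 * s - 3 * w) % 4319)) % 4319 := by
        clear h1 e1 ih h
        omega
      rw [e1, e2]
      rcases h1 with h1 | h1 | h1 | h1 | h1 | h1 | h1 <;> rw [h1.1, h1.2] <;> decide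

/-- The only squares that are a sum of a power of `7` and a power of `2`, with positive exponents,
are `9` and `81`. -/
lemma seven_pow_add_two_pow_eq_sq {w : ℤ} {x y : ℕ} (hw : 0 < w) (hx : 0 < x) (hy : 0 < y)
    (h : 7 ^ x + 2 ^ y = w ^ 2) : (x = 1 ∧ y = 1 ∧ w = 3) ∨ (x = 2 ∧ y = 5 ∧ w = 9) := by
  have hodd : Odd w := by
    have h1 : Odd (w ^ 2) := by
      rw [← h]
      exact Odd.add_even (Odd.pow (by decide)) (Int.even_pow.mpr ⟨by decide, hy.ne'⟩)
    exact (Int.odd_pow' two_ne_zero).mp h1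
  have hw8 : w ^ 2 % 8 = 1 := by have := Int.eight_dvd_sq_sub_one_of_odd hodd; omega
  have h49 : ∀ m : ℕ, (49 : ℤ) ^ m % 16 = 1 := fun m => by
    have := (show (49 : ℤ) ≡ 1 [ZMOD 16] by decide).pow m
    rw [one_pow] at this
    exact this
  have hlow : ∀ n : ℕ, n < 4 ∨ (16 : ℤ) ∣ 2 ^ n := fun n => by
    rcases lt_or_ge n 4 with h | h
    · exact Or.inl h
    · exact Or.inr (pow_dvd_pow (2 : ℤ) h)
  rcases Nat.even_or_odd' x with ⟨m, rfl | rfl⟩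
  · right
    have hpow : (7 : ℤ) ^ (2 * m) = 49 ^ m := by rw [pow_mul]; norm_num
    obtain ⟨n, rfl⟩ | rfl : (∃ n, y = n + 2) ∨ y = 1 := by
      rcases y with _ | _ | n
      · omega
      · exact Or.inr rfl
      · exact Or.inl ⟨n, rfl⟩
    · obtain ⟨h1, h2⟩ := eq_two_pow_add_one_of_sq_add (u := 7 ^ m) (y := n) hw hodd
        (by rw [← h]; ring)
      have h3 : (7 : ℤ) ^ m = 2 ^ n - 1 :=
        (pow_left_inj₀ (by positivity)
          (sub_nonneg.mpr (one_le_pow₀ (by norm_num))) two_ne_zero).mp h2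
      have h4 : (7 : ℤ) ^ m % 16 = 1 ∨ (7 : ℤ) ^ m % 16 = 7 := by
        rcases Nat.even_or_odd' m with ⟨l, rfl | rfl⟩
        · have := h49 l
          left
          rw [pow_mul]
          norm_num [this]
        · have := h49 l
          right
          rw [pow_succ, pow_mul]
          norm_num [Int.mul_emod, this]
      have h5 : (7 : ℤ) ≤ 7 ^ m := by
        calc (7 : ℤ) = 7 ^ 1 := by norm_num
          _ ≤ 7 ^ m := pow_le_pow_right₀ (by norm_num) (by omega)
      rcases hlow n with h6 | h6
      · interval_cases n <;> norm_num at h3 <;> try omega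
        have hm : m = 1 := by
          have : (7 : ℤ) ^ m = 7 ^ 1 := by rw [h3]; norm_num
          exact_mod_cast pow_right_injective₀ (by norm_num) (by norm_num) this
        subst hm
        norm_num at h1
        exact ⟨rfl, rfl, h1⟩
      · omega
    · have := h49 m
      rw [hpow] at h
      omega
  · left
    have hpow : (7 : ℤ) ^ (2 * m + 1) = 7 * 49 ^ m := by rw [pow_succ, pow_mul]; norm_num; ring
    have h1 := h49 m
    have hy1 : y = 1 := by
      rw [hpow] at h
      rcases hlow y with h6 | h6
      · interval_cases y <;> norm_num at h <;> omega
      · omega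
    subst hy1
    have hm : m = 0 := by
      by_contra hm
      have h2 := dvd_of_seven_dvd_of_sq_sub hw (s := 7 ^ m) (by positivity)
        (by rw [← h]; ring) (dvd_pow_self _ hm)
      have h3 : Prime (617 : ℤ) := Nat.prime_iff_prime_int.mp (by norm_num)
      exact absurd (h3.dvd_of_dvd_pow h2) (by decide)
    subst hm
    exact ⟨rfl, rfl, by nlinarith⟩

lemma sq_eq_sq_of_norm_eq_seven_pow {D X Y a b : ℤ} {L : ℕ} (hD : 1 < D) (hL : L ≠ 0)
    (h1 : X ^ 2 + D * Y ^ 2 = 7 ^ L) (h2 : a ^ 2 + D * b ^ 2 = 7 ^ L) (hX : ¬ 7 ∣ X)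
    (ha : ¬ 7 ∣ a) : Y ^ 2 = b ^ 2 := by
  have h7 : Prime (7 : ℤ) := Nat.prime_iff_prime_int.mp (by norm_num)
  have hM : (7 : ℤ) ^ L ≠ 0 := by positivity
  have hprod : (X * b - a * Y) * (X * b + a * Y) = 7 ^ L * (b ^ 2 - Y ^ 2) := by
    linear_combination b ^ 2 * h1 - Y ^ 2 * h2
  have hzero : ∀ Y' : ℤ, (X * a + D * Y' * b) ^ 2 + D * (X * b - a * Y') ^ 2 = (7 ^ L) ^ 2 →
      7 ^ L ∣ X * b - a * Y' → X * b - a * Y' = 0 := by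
    rintro Y' h3 ⟨r, hr⟩
    rw [hr] at h3 ⊢
    by_contra hne
    have hr0 : r ≠ 0 := fun hr0 => hne (by rw [hr0, mul_zero])
    have hr1 : 1 ≤ r ^ 2 := by
      have : 0 < r ^ 2 := by positivity
      omega
    have h4 : 0 < ((7 : ℤ) ^ L) ^ 2 := by positivity
    nlinarith [sq_nonneg (X * a + D * Y' * b), mul_le_mul_of_nonneg_left hr1 h4.le]
  have hzero' : X * b - a * Y = 0 ∨ X * b - a * -Y = 0 := by
    by_cases hd : (7 : ℤ) ∣ X * b - a * Y
    · have hd' : ¬ (7 : ℤ) ∣ X * b + a * Y := by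
        intro hd'
        have h3 : (7 : ℤ) ∣ 2 * a * Y := by
          rw [show 2 * a * Y = (X * b + a * Y) - (X * b - a * Y) by ring]
          exact dvd_sub hd' hd
        have h4 : (7 : ℤ) ∣ Y :=
          (h7.dvd_or_dvd h3).resolve_left fun h => (h7.dvd_or_dvd h).elim (by decide) ha
        refine hX (h7.dvd_of_dvd_pow (n := 2) ?_)
        rw [← Int.dvd_add_left ((dvd_pow h4 two_ne_zero).mul_left D), h1]
        exact dvd_pow_self _ hL
      left
      exact hzero Y (by linear_combination 7 ^ L * h1 + (X ^ 2 + D * Y ^ 2) * h2)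
        (h7.pow_dvd_of_dvd_mul_right L hd' ⟨_, hprod⟩)
    · right
      refine hzero (-Y) (by linear_combination 7 ^ L * h1 + (X ^ 2 + D * Y ^ 2) * h2) ?_
      rw [mul_neg, sub_neg_eq_add]
      exact h7.pow_dvd_of_dvd_mul_left L hd ⟨_, hprod⟩
  have hprod0 : (X * b - a * Y) * (X * b + a * Y) = 0 := by
    rcases hzero' with h | h
    · rw [h, zero_mul]
    · rw [mul_neg, sub_neg_eq_add] at h
      rw [h, mul_zero]
  rw [hprod] at hprod0
  have := (mul_eq_zero.mp hprod0).resolve_left hM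
  linarith

lemma sq_eq_sq_of_norm_eq_four_mul_two_pow {D X Y a b : ℤ} {L : ℕ} (hD : 0 < D)
    (h1 : X ^ 2 + D * Y ^ 2 = 4 * 2 ^ L) (h2 : a ^ 2 + D * b ^ 2 = 4 * 2 ^ L) (hX : Odd X)
    (hY : Odd Y) (ha : Odd a) (hb : Odd b) : Y ^ 2 = b ^ 2 := by
  have hprod : ∀ Y' : ℤ, Y' ^ 2 = Y ^ 2 →
      (X * b - a * Y') * (X * b + a * Y') = 4 * 2 ^ L * (b ^ 2 - Y ^ 2) := fun Y' hY' => by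
    linear_combination b ^ 2 * h1 - Y ^ 2 * h2 - a ^ 2 * hY'
  obtain ⟨r, hr⟩ : 8 ∣ b ^ 2 - Y ^ 2 := by
    rw [← sub_sub_sub_cancel_right _ _ 1]
    exact dvd_sub (Int.eight_dvd_sq_sub_one_of_odd hb) (Int.eight_dvd_sq_sub_one_of_odd hY)
  have key : ∀ Y' : ℤ, Y' ^ 2 = Y ^ 2 → ¬ 4 ∣ X * b + a * Y' → 2 ∣ X * b + a * Y' →
      Y ^ 2 = b ^ 2 := by
    rintro Y' hY' h4 ⟨q, hq⟩
    have hqodd : IsCoprime (2 ^ (L + 4)) q := by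
      refine (Int.isCoprime_two_left.mpr (Int.not_even_iff_odd.mp fun hqe => h4 ?_)).pow_left
      obtain ⟨l, rfl⟩ := hqe
      exact ⟨l, by linarith⟩
    have hdvd : 2 ^ (L + 4) ∣ X * b - a * Y' := by
      refine hqodd.dvd_of_dvd_mul_right ⟨r, ?_⟩
      have := hprod Y' hY'
      rw [hq, hr] at this
      have h3 : (2 : ℤ) * ((X * b - a * Y') * q) = 2 * (2 ^ (L + 4) * r) := by
        linear_combination this
      linarith
    obtain ⟨l, hl⟩ := hdvd
    have h5 : (X * a + D * Y' * b) ^ 2 + D * (X * b - a * Y') ^ 2 = (4 * 2 ^ L) ^ 2 := by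
      linear_combination 4 * 2 ^ L * h1 + (X ^ 2 + D * Y ^ 2) * h2 +
        D * (a ^ 2 + D * b ^ 2) * hY'
    have hl0 : l = 0 := by
      by_contra hne
      have hl1 : 1 ≤ l ^ 2 := by
        have : 0 < l ^ 2 := by positivity
        omega
      rw [hl, pow_add] at h5
      have h6 : 0 < ((2 : ℤ) ^ L) ^ 2 := by positivity
      have h7 : 1 * 1 ≤ D * l ^ 2 := mul_le_mul hD hl1 (by norm_num) hD.le
      nlinarith [sq_nonneg (X * a + D * Y' * b), mul_le_mul_of_nonneg_left h7 h6.le]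
    have h6 := hprod Y' hY'
    rw [hl, hl0, mul_zero, zero_mul] at h6
    have h7 : (4 * 2 ^ L : ℤ) ≠ 0 := by positivity
    have := (mul_eq_zero.mp h6.symm).resolve_left h7
    linarith
  have hXb : (X * b) % 2 = 1 := Int.odd_iff.mp (hX.mul hb)
  have haY : (a * Y) % 2 = 1 := Int.odd_iff.mp (ha.mul hY)
  by_cases h4 : 4 ∣ X * b + a * Y
  · apply key (-Y) (neg_sq Y) <;> rw [mul_neg] <;> omega
  · exact key Y rfl h4 (by omega)

lemma Zsqrtd.not_dvd_re_pow {d p : ℤ} (hp : Prime p) {A : ℤ√d} (hA : p ∣ A.norm)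
    (hre : ¬ p ∣ 2 * A.re) (n : ℕ) : ¬ p ∣ (A ^ n).re := by
  induction n using Nat.twoStepInduction with
  | zero => simpa using hp.not_dvd_one
  | one => simpa using fun h => hre (h.mul_left 2)
  | more n h1 h2 =>
    intro h
    rw [Zsqrtd.pow_add_two, Zsqrtd.re_sub, Zsqrtd.re_smul, Zsqrtd.re_smul,
      dvd_sub_left (hA.mul_right _)] at h
    exact (hp.dvd_or_dvd h).elim hre h2

lemma Zsqrtd.exists_pow_eq_two_pow_mul {d q : ℤ} {A : ℤ√d} (hre : Odd A.re) (him : Odd A.im)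
    (hA : A.norm = 8 * q) (n : ℕ) :
    ∃ Z : ℤ√d, A ^ (n + 1) = ((2 ^ n : ℤ) : ℤ√d) * Z ∧ Odd Z.re ∧ Odd Z.im := by
  have hstep : ∀ n (Z W : ℤ√d), A ^ (n + 1) = ((2 ^ n : ℤ) : ℤ√d) * Z →
      A ^ (n + 2) = ((2 ^ (n + 1) : ℤ) : ℤ√d) * W →
      A ^ (n + 3) = ((2 ^ (n + 2) : ℤ) : ℤ√d) * ((A.re : ℤ) * W - (2 * q : ℤ) * Z) := by
    intro n Z W h1 h2
    rw [Zsqrtd.pow_add_two, h1, h2, hA]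
    push_cast
    ring
  induction n using Nat.twoStepInduction with
  | zero => exact ⟨A, by simp, hre, him⟩
  | one =>
    refine ⟨(A.re : ℤ) * A - (4 * q : ℤ), ?_, ?_, ?_⟩
    · rw [Zsqrtd.pow_add_two A 0, hA]
      push_cast
      ring
    · rw [Zsqrtd.re_sub, Zsqrtd.re_smul, Zsqrtd.re_intCast]
      exact (hre.mul hre).sub_even ⟨2 * q, by ring⟩
    · rw [Zsqrtd.im_sub, Zsqrtd.im_smul, Zsqrtd.im_intCast, sub_zero]
      exact hre.mul him
  | more n h1 h2 =>
    obtain ⟨Z, hZ, _, _⟩ := h1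
    obtain ⟨W, hW, hW1, hW2⟩ := h2
    refine ⟨_, hstep n Z W hZ hW, ?_, ?_⟩
    · rw [Zsqrtd.re_sub, Zsqrtd.re_smul, Zsqrtd.re_smul]
      exact (hre.mul hW1).sub_even ⟨q * Z.re, by ring⟩
    · rw [Zsqrtd.im_sub, Zsqrtd.im_smul, Zsqrtd.im_smul]
      exact (hre.mul hW2).sub_even ⟨q * Z.im, by ring⟩

lemma even_of_three_dvd_two_pow_sub_one {n : ℕ} (h : (3 : ℤ) ∣ 2 ^ n - 1) : Even n := by
  rcases Nat.even_or_odd' n with ⟨m, rfl | rfl⟩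
  · exact even_two_mul m
  · have h1 := (show (4 : ℤ) ≡ 1 [ZMOD 3] by decide).pow m
    rw [one_pow, Int.ModEq] at h1
    rw [pow_succ, pow_mul] at h
    norm_num at h
    omega

lemma even_of_eight_dvd_seven_pow_sub_one {n : ℕ} (h : (8 : ℤ) ∣ 7 ^ n - 1) : Even n := by
  rcases Nat.even_or_odd' n with ⟨m, rfl | rfl⟩
  · exact even_two_mul m
  · have h1 := (show (49 : ℤ) ≡ 1 [ZMOD 8] by decide).pow m
    rw [one_pow, Int.ModEq] at h1
    rw [pow_succ, pow_mul] at h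
    norm_num at h
    omega

lemma seven_pow_sub_two_pow_ne_of_pos {x y X Y : ℕ} (hx : 0 < x) (hy : 0 < y) (hxX : x < X)
    (hyY : y < Y) (hpos : (0 : ℤ) < 7 ^ x - 2 ^ y) : (7 : ℤ) ^ X - 2 ^ Y ≠ 7 ^ x - 2 ^ y := by
  intro h
  have h7 : Prime (7 : ℤ) := Nat.prime_iff_prime_int.mp (by norm_num)
  have h3 : Prime (3 : ℤ) := Nat.prime_iff_prime_int.mp (by norm_num)
  obtain ⟨e, rfl⟩ : ∃ e, X = x + e := ⟨X - x, by omega⟩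
  have h73 : ∀ n : ℕ, (7 : ℤ) ^ n % 3 = 1 := fun n => by
    have := (show (7 : ℤ) ≡ 1 [ZMOD 3] by decide).pow n
    rwa [one_pow] at this
  obtain ⟨g, rfl⟩ : ∃ g, Y = y + 2 * g := by
    have h1 : (3 : ℤ) ∣ 2 ^ y * (2 ^ (Y - y) - 1) := by
      have h2 : (2 : ℤ) ^ y * (2 ^ (Y - y) - 1) = 2 ^ Y - 2 ^ y := by
        rw [mul_sub, ← pow_add, mul_one]; congr 2; omega
      have := h73 (x + e)
      have := h73 x
      rw [h2]
      omega
    obtain ⟨g, hg⟩ := even_of_three_dvd_two_pow_sub_one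
      ((h3.dvd_or_dvd h1).resolve_left fun h2 => absurd (h3.dvd_of_dvd_pow h2) (by decide))
    exact ⟨g, by omega⟩
  have hg : g ≠ 0 := by omega
  obtain ⟨V, n, hV, hVt⟩ : ∃ (V : ℤ) (n : ℕ), (V = 1 ∨ V = 2) ∧ 2 ^ y = V * (2 ^ n) ^ 2 := by
    rcases Nat.even_or_odd' y with ⟨n, rfl | rfl⟩
    · exact ⟨1, n, by simp, by ring⟩
    · exact ⟨2, n, by simp, by ring⟩
  set d : ℤ := 7 ^ x - 2 ^ y with hd
  set t : ℤ := 2 ^ n with ht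
  have ht0 : t ≠ 0 := by positivity
  have hdodd : ¬ 2 ∣ d := by
    have h1 : Odd d := (Odd.pow (by decide)).sub_even (Int.even_pow.mpr ⟨by decide, hy.ne'⟩)
    rwa [← even_iff_two_dvd, Int.not_even_iff_odd]
  have hD : 1 < V * d := by
    rcases hV with rfl | rfl
    · rcases eq_or_lt_of_le (show 1 ≤ d from hpos) with h1 | h1
      · have h4 := h73 x
        have h5 : (3 : ℤ) ∣ 2 ^ y := by omega
        exact absurd (h3.dvd_of_dvd_pow h5) (by decide)
      · omega
    · omega
  have hVT : (2 : ℤ) ^ (y + 2 * g) = V * (2 ^ g * t) ^ 2 := by rw [pow_add, hVt]; ring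
  set A : ℤ√(-(V * d)) := ⟨2 ^ (y + 2 * g) - d, 2 * (2 ^ g * t)⟩ with hA
  set B : ℤ√(-(V * d)) := ⟨2 ^ y - d, 2 * t⟩ with hB
  have hAn : A.norm = 7 ^ (2 * (x + e)) := by
    have h1 : (7 : ℤ) ^ (x + e) = 2 ^ (y + 2 * g) + d := by linarith
    rw [mul_comm 2, pow_mul, h1, Zsqrtd.norm_def]
    linear_combination -4 * d * hVT
  have hBn : B.norm = 7 ^ (2 * x) := by
    have h1 : (7 : ℤ) ^ x = 2 ^ y + d := by rw [hd]; ring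
    rw [mul_comm 2, pow_mul, h1, Zsqrtd.norm_def]
    linear_combination -4 * d * hVt
  have h7two : ∀ n : ℕ, ¬ (7 : ℤ) ∣ 2 * (2 * 2 ^ n) := fun n h1 => by
    rw [show (2 : ℤ) * (2 * 2 ^ n) = 2 ^ (n + 2) by ring] at h1
    exact absurd (h7.dvd_of_dvd_pow h1) (by decide)
  have hAre : ∀ n, ¬ (7 : ℤ) ∣ (A ^ n).re := Zsqrtd.not_dvd_re_pow h7
    (by rw [hAn]; exact dvd_pow_self _ (by omega)) (by
      have h1 : 2 * A.re = 2 * (2 * 2 ^ (y + 2 * g)) - 2 * 7 ^ (x + e) := by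
        simp only [hA]; linarith
      rw [h1, dvd_sub_left ((dvd_pow_self _ (by omega)).mul_left 2)]
      exact h7two _)
  have hBre : ∀ n, ¬ (7 : ℤ) ∣ (B ^ n).re := Zsqrtd.not_dvd_re_pow h7
    (by rw [hBn]; exact dvd_pow_self _ (by omega)) (by
      have h1 : 2 * B.re = 2 * (2 * 2 ^ y) - 2 * 7 ^ x := by
        simp only [hB, hd]; ring
      rw [h1, dvd_sub_left ((dvd_pow_self _ (by omega)).mul_left 2)]
      exact h7two _)
  have hsq : (A ^ x).im ^ 2 = (B ^ (x + e)).im ^ 2 := by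
    refine sq_eq_sq_of_norm_eq_seven_pow (L := 2 * (x + e) * x) hD (by positivity) ?_ ?_
      (hAre x) (hBre (x + e))
    · rw [pow_mul, ← hAn, ← Zsqrtd.norm_pow, Zsqrtd.norm_def]; ring
    · rw [mul_right_comm 2, pow_mul, ← hBn, ← Zsqrtd.norm_pow, Zsqrtd.norm_def]; ring
  rw [Zsqrtd.im_pow, Zsqrtd.im_pow B] at hsq
  set S' := lucasU (2 * B.re) B.norm (x + e) with hS'
  have hdvd : (2 : ℤ) ^ g ∣ S' := by
    rw [← Int.pow_dvd_pow_iff two_ne_zero]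
    refine ⟨lucasU (2 * A.re) A.norm x ^ 2, ?_⟩
    apply mul_left_cancel₀ (show (2 * t) ^ 2 ≠ 0 by positivity)
    simp only [hA, hB] at hsq ⊢
    linear_combination -hsq
  have hgX : 2 ^ g ∣ x + e :=
    Zsqrtd.pow_dvd_of_pow_dvd_lucasU (p := 2) Nat.prime_two exists_lucasU_two_eq B
      (mul_ne_zero two_ne_zero ht0) (Dvd.dvd.mul_left (Dvd.dvd.pow ⟨t, rfl⟩ two_ne_zero) _)
      (by
        push_cast
        exact fun h1 => hdodd ((dvd_sub_right (dvd_pow_self _ hy.ne')).mp h1)) g (x + e)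
      (by exact_mod_cast hdvd)
  have hfac : (7 : ℤ) ^ x * (7 ^ e - 1) = 2 ^ y * (4 ^ g - 1) := by
    have h1 : (4 : ℤ) ^ g = 2 ^ (2 * g) := by rw [pow_mul]; norm_num
    rw [h1, mul_sub, mul_sub, ← pow_add, ← pow_add]
    linarith
  have hg4 : (1 : ℤ) < 4 ^ g := one_lt_pow₀ (by norm_num) hg
  have hy0 : (0 : ℤ) < 2 ^ y := by positivity
  have h7e : (7 : ℤ) ^ e < 4 ^ g := by
    by_contra! hcon
    nlinarith
  have h7x : (7 : ℤ) ^ x < 4 ^ g := by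
    have h1 : (7 : ℤ) ^ x ∣ 4 ^ g - 1 :=
      (IsCoprime.pow (show IsCoprime (7 : ℤ) 2 by norm_num)).dvd_of_dvd_mul_left ⟨_, hfac.symm⟩
    have := Int.le_of_dvd (by linarith) h1
    linarith
  have hlt : (7 : ℤ) ^ (x + e) < 16 ^ g := by
    rw [pow_add, show (16 : ℤ) = 4 * 4 by norm_num, mul_pow]
    exact mul_lt_mul'' h7x h7e (by positivity) (by positivity)
  have hge : 2 * g ≤ x + e := by
    refine le_trans ?_ (Nat.le_of_dvd (by omega) hgX)
    obtain ⟨g, rfl⟩ := Nat.exists_eq_succ_of_ne_zero hg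
    have := Nat.lt_two_pow_self (n := g)
    rw [Nat.succ_eq_add_one, pow_succ]
    omega
  have h49 : (16 : ℤ) ^ g ≤ 7 ^ (2 * g) := by
    rw [pow_mul]
    exact pow_le_pow_left₀ (by norm_num) (by norm_num) g
  have := pow_le_pow_right₀ (show (1 : ℤ) ≤ 7 by norm_num) hge
  linarith

lemma two_pow_sub_seven_pow_ne_of_pos {x y X Y : ℕ} (hx : 0 < x) (hxX : x < X)
    (hyY : y < Y) (hpos : (0 : ℤ) < 2 ^ y - 7 ^ x) : (2 : ℤ) ^ Y - 7 ^ X ≠ 2 ^ y - 7 ^ x := by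
  intro h
  have h7 : Prime (7 : ℤ) := Nat.prime_iff_prime_int.mp (by norm_num)
  have hcop : IsCoprime (7 : ℤ) 2 := by norm_num
  have h7x : (7 : ℤ) ≤ 7 ^ x := le_self_pow₀ (by norm_num) hx.ne'
  obtain ⟨r, rfl⟩ : ∃ r, y = r + 3 := by
    refine ⟨y - 3, ?_⟩
    by_contra hcon
    have : y ≤ 2 := by omega
    have : (2 : ℤ) ^ y ≤ 2 ^ 2 := pow_le_pow_right₀ (by norm_num) this
    linarith
  obtain ⟨f, rfl⟩ : ∃ f, Y = r + 3 + f := ⟨Y - (r + 3), by omega⟩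
  obtain ⟨i, rfl⟩ : ∃ i, X = x + 2 * i := by
    have h1 : (8 : ℤ) ∣ 7 ^ x * (7 ^ (X - x) - 1) := by
      refine ⟨2 ^ (r + f) - 2 ^ r, ?_⟩
      have h2 : (7 : ℤ) ^ x * (7 ^ (X - x) - 1) = 7 ^ X - 7 ^ x := by
        rw [mul_sub, ← pow_add, mul_one]; congr 2; omega
      rw [h2]
      linear_combination -h
    have h2 : IsCoprime (8 : ℤ) (7 ^ x) := IsCoprime.pow_right (by norm_num)
    obtain ⟨i, hi⟩ := even_of_eight_dvd_seven_pow_sub_one (h2.dvd_of_dvd_mul_left h1)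
    exact ⟨i, by omega⟩
  have hi : i ≠ 0 := by omega
  obtain ⟨U, m, hU, hUm⟩ : ∃ (U : ℤ) (m : ℕ), 0 < U ∧ 7 ^ x = U * (7 ^ m) ^ 2 := by
    rcases Nat.even_or_odd' x with ⟨m, rfl | rfl⟩
    · exact ⟨1, m, by simp, by ring⟩
    · exact ⟨7, m, by simp, by ring⟩
  set d : ℤ := 2 ^ (r + 3) - 7 ^ x with hd
  have hUS : (7 : ℤ) ^ (x + 2 * i) = U * (7 ^ (m + i)) ^ 2 := by rw [pow_add, hUm]; ring
  set A : ℤ√(-(U * d)) := ⟨7 ^ (x + 2 * i) - 2 ^ (r + 2 + f), 7 ^ (m + i)⟩ with hA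
  set B : ℤ√(-(U * d)) := ⟨7 ^ x - 2 ^ (r + 2), 7 ^ m⟩ with hB
  have hAn : A.norm = 4 ^ (r + 2 + f) := by
    have h1 : (7 : ℤ) ^ (x + 2 * i) = 2 * 2 ^ (r + 2 + f) - d := by
      rw [← pow_succ', show r + 2 + f + 1 = r + 3 + f by ring]; linarith
    have h2 : (4 : ℤ) ^ (r + 2 + f) = (2 ^ (r + 2 + f)) ^ 2 := by
      rw [← pow_mul, mul_comm _ 2, pow_mul]; norm_num
    rw [h2, Zsqrtd.norm_def]
    simp only [hA]
    linear_combination -d * hUS + (7 ^ (x + 2 * i)) * h1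
  have hBn : B.norm = 4 ^ (r + 2) := by
    have h1 : (7 : ℤ) ^ x = 2 * 2 ^ (r + 2) - d := by rw [← pow_succ', hd]; ring
    have h2 : (4 : ℤ) ^ (r + 2) = (2 ^ (r + 2)) ^ 2 := by
      rw [← pow_mul, mul_comm _ 2, pow_mul]; norm_num
    rw [h2, Zsqrtd.norm_def]
    simp only [hB]
    linear_combination -d * hUm + (7 ^ x) * h1
  have h7odd : ∀ n : ℕ, Odd ((7 : ℤ) ^ n) := fun n => Odd.pow (by decide)
  have hodd : ∀ a b : ℕ, b ≠ 0 → Odd ((7 : ℤ) ^ a - 2 ^ b) := fun a b hb =>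
    (h7odd a).sub_even (Int.even_pow.mpr ⟨by decide, hb⟩)
  obtain ⟨Z, hZ, hZre, hZim⟩ := Zsqrtd.exists_pow_eq_two_pow_mul (A := A) (q := 2 * 4 ^ (r + f))
    (hodd _ _ (by omega)) (h7odd _) (by rw [hAn]; ring) r
  obtain ⟨W, hW, hWre, hWim⟩ := Zsqrtd.exists_pow_eq_two_pow_mul (A := B) (q := 2 * 4 ^ r)
    (hodd _ _ (by omega)) (h7odd _) (by rw [hBn]; ring) (r + f)
  have hnorm : ∀ (E F : ℤ√(-(U * d))) (n l : ℕ), E.norm = 4 ^ (l + 2) →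
      E ^ (n + 1) = ((2 ^ n : ℤ) : ℤ√(-(U * d))) * F →
      F.re ^ 2 + U * d * F.im ^ 2 = 4 * 2 ^ (2 * ((n + 1) * (l + 1))) := by
    intro E F n l hE hF
    have h1 := congrArg Zsqrtd.norm hF
    rw [Zsqrtd.norm_pow, Zsqrtd.norm_mul, Zsqrtd.norm_intCast, hE] at h1
    have h2 : F.norm = F.re ^ 2 + U * d * F.im ^ 2 := by rw [Zsqrtd.norm_def]; ring
    rw [← h2]
    apply mul_left_cancel₀ (show (2 ^ n * 2 ^ n : ℤ) ≠ 0 by positivity)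
    rw [← h1, show (4 : ℤ) = 2 ^ 2 by norm_num, ← pow_mul, ← pow_mul, ← pow_add, ← pow_add,
      ← pow_add]
    congr 1
    ring
  have hZW : Z.im ^ 2 = W.im ^ 2 :=
    sq_eq_sq_of_norm_eq_four_mul_two_pow (mul_pos hU hpos)
      (hnorm A Z r (r + f) (by rw [hAn]; ring) hZ)
      (by rw [mul_comm (r + 1)]; exact hnorm B W (r + f) r hBn hW) hZre hZim hWre hWim
  have hZ' := congrArg Zsqrtd.im hZ
  have hW' := congrArg Zsqrtd.im hW
  rw [Zsqrtd.im_pow, Zsqrtd.im_smul] at hZ' hW'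
  set S := lucasU (2 * B.re) B.norm (r + f + 1) with hS
  have hdvd : (7 : ℤ) ^ i ∣ S := by
    have h1 : (7 : ℤ) ^ (m + i) ∣ Z.im :=
      (hcop.pow (m := m + i) (n := r)).dvd_of_dvd_mul_left ⟨_, hZ'.symm⟩
    have h2 : (7 : ℤ) ^ (m + i) ∣ W.im := by
      rw [← Int.pow_dvd_pow_iff two_ne_zero, ← hZW]
      exact pow_dvd_pow_of_dvd h1 2
    have h3 : (7 : ℤ) ^ m * 7 ^ i ∣ 7 ^ m * S := by
      rw [← pow_add, hW']
      exact h2.mul_left _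
    exact (mul_dvd_mul_iff_left (by positivity)).mp h3
  have hiY : 7 ^ i ∣ r + f + 1 :=
    Zsqrtd.pow_dvd_of_pow_dvd_lucasU (p := 7) (by norm_num) exists_lucasU_seven_eq B
      (show (7 : ℤ) ^ m ≠ 0 by positivity) (by
        have h1 : -(U * d) * (7 ^ m) ^ 2 = 7 ^ x * -d := by rw [hUm]; ring
        simp only [hB, h1]
        exact_mod_cast (dvd_pow_self (7 : ℤ) hx.ne').mul_right _)
      (by
        push_cast
        intro h1
        have h2 := (dvd_sub_right (dvd_pow_self (7 : ℤ) hx.ne')).mp h1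
        exact absurd (h7.dvd_of_dvd_pow h2) (by decide)) i _
      (by exact_mod_cast hdvd)
  have hfac : (2 : ℤ) ^ (r + 3) * (2 ^ f - 1) = 7 ^ x * (49 ^ i - 1) := by
    have h1 : (49 : ℤ) ^ i = 7 ^ (2 * i) := by rw [pow_mul]; norm_num
    rw [h1, mul_sub, mul_sub, ← pow_add, ← pow_add]
    linarith
  have hi49 : (1 : ℤ) < 49 ^ i := one_lt_pow₀ (by norm_num) hi
  have h2f : (2 : ℤ) ^ f < 49 ^ i := by
    by_contra! hcon
    nlinarith
  have hydvd : (2 : ℤ) ^ (r + 3) ∣ 49 ^ i - 1 :=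
    (hcop.symm.pow (m := r + 3) (n := x)).dvd_of_dvd_mul_left ⟨_, hfac.symm⟩
  have h2y : (2 : ℤ) ^ (r + 3) < 49 ^ i := by
    have := Int.le_of_dvd (by linarith) hydvd
    linarith
  have hlt : (2 : ℤ) ^ (r + 3 + f) < 2 ^ (12 * i) := by
    calc (2 : ℤ) ^ (r + 3 + f) = 2 ^ (r + 3) * 2 ^ f := pow_add ..
      _ < 49 ^ i * 49 ^ i := mul_lt_mul'' h2y h2f (by positivity) (by positivity)
      _ = 2401 ^ i := by rw [← mul_pow]; norm_num
      _ ≤ 4096 ^ i := pow_le_pow_left₀ (by norm_num) (by norm_num) i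
      _ = 2 ^ (12 * i) := by rw [pow_mul]; norm_num
  have hlt' : r + 3 + f < 12 * i := (pow_lt_pow_iff_right₀ (by norm_num)).mp hlt
  have hle := Nat.le_of_dvd (by omega) hiY
  have hi1 : i = 1 := by
    have key : ∀ n : ℕ, 12 * (n + 2) ≤ 7 ^ (n + 2) := fun n => by
      induction n with
      | zero => norm_num
      | succ n ih => rw [show n + 1 + 2 = (n + 2) + 1 by ring, pow_succ]; omega
    rcases i with _ | _ | n
    · omega
    · rfl
    · have := (key n).trans hle
      omega
  subst hi1
  norm_num at hydvd h2f h2y hiY hle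
  have hr : r ≤ 1 := by
    by_contra hcon
    have h1 : (2 : ℤ) ^ 5 ∣ 48 := (pow_dvd_pow 2 (by omega)).trans hydvd
    norm_num at h1
  have hf : f ≤ 5 := by
    by_contra hcon
    have : (2 : ℤ) ^ 6 ≤ 2 ^ f := pow_le_pow_right₀ (by norm_num) (by omega)
    linarith
  obtain ⟨rfl, rfl⟩ : r = 1 ∧ f = 5 := by omega
  norm_num at hfac
  omega

/-- A positive integer is the sum of a power of `7` and a power of `2`, with positive exponents, in
at most one way. -/
lemma eq_of_seven_pow_add_two_pow_eq {x y X Y : ℕ} (hx : 0 < x) (hy : 0 < y) (hX : 0 < X)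
    (hY : 0 < Y) (h : 7 ^ x + 2 ^ y = 7 ^ X + 2 ^ Y) : x = X ∧ y = Y := by
  wlog hxX : x ≤ X generalizing x y X Y
  · have := this hX hY hx hy h.symm (by omega)
    exact ⟨this.1.symm, this.2.symm⟩
  have hz : (7 : ℤ) ^ x + 2 ^ y = 7 ^ X + 2 ^ Y := by exact_mod_cast h
  rcases hxX.eq_or_lt with rfl | hxX
  · exact ⟨rfl, Nat.pow_right_injective le_rfl (Nat.add_left_cancel h)⟩
  exfalso
  have hYy : Y < y := by
    have h1 : 7 ^ x < 7 ^ X := Nat.pow_lt_pow_right (by norm_num) hxX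
    exact (Nat.pow_lt_pow_iff_right (by norm_num)).mp (by omega : 2 ^ Y < 2 ^ y)
  rcases lt_trichotomy ((7 : ℤ) ^ x) (2 ^ Y) with hlt | heq | hlt
  · exact two_pow_sub_seven_pow_ne_of_pos hx hxX hYy (by linarith) (by linarith)
  · have h1 : Odd ((7 : ℤ) ^ x) := Odd.pow (by decide)
    have h2 : Even ((2 : ℤ) ^ Y) := Int.even_pow.mpr ⟨by decide, hY.ne'⟩
    rw [heq] at h1
    exact Int.not_even_iff_odd.mpr h1 h2
  · exact seven_pow_sub_two_pow_ne_of_pos hx hY hxX hYy (by linarith) (by linarith)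

/-- The only perfect powers that are a sum of a power of `7` and a power of `2`, with positive
exponents, are `9` and `81`. -/
lemma exponent_eq_one_or {c x y z : ℕ} (hc : 0 < c) (hx : 0 < x) (hy : 0 < y) (hz : 0 < z)
    (h : 7 ^ x + 2 ^ y = c ^ z) : z = 1 ∨ (c = 3 ∧ x = 1 ∧ y = 1 ∧ z = 2) ∨
      (c = 9 ∧ x = 2 ∧ y = 5 ∧ z = 2) ∨ (c = 3 ∧ x = 2 ∧ y = 5 ∧ z = 4) := by
  by_cases hz1 : z = 1
  · exact Or.inl hz1
  right
  have hprime : ∀ p, p.Prime → p ∣ z → p = 2 := by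
    rintro p hp ⟨n, rfl⟩
    by_contra hp2
    refine seven_pow_add_two_pow_ne_prime_pow (C := (c : ℤ) ^ n) hx hy (by positivity) hp hp2 ?_
    rw [← pow_mul, mul_comm n]
    exact_mod_cast h
  obtain ⟨p, hp, hpz⟩ := Nat.exists_prime_and_dvd hz1
  rw [hprime p hp hpz] at hpz
  obtain ⟨n, rfl⟩ := hpz
  have hsq : (7 : ℤ) ^ x + 2 ^ y = ((c : ℤ) ^ n) ^ 2 := by
    rw [← pow_mul, mul_comm n]
    exact_mod_cast h
  have hn : n ≠ 0 := by omega
  rcases seven_pow_add_two_pow_eq_sq (by positivity) hx hy hsq with ⟨rfl, rfl, h3⟩ | ⟨rfl, rfl, h9⟩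
  · left
    have h3' : c ^ n = 3 ^ 1 := by exact_mod_cast h3
    obtain ⟨k, hk, rfl⟩ := (Nat.dvd_prime_pow Nat.prime_three).mp
      ((dvd_pow_self c hn).trans (dvd_of_eq h3'))
    rw [← pow_mul] at h3'
    have hkn : k * n = 1 := Nat.pow_right_injective (by norm_num : 2 ≤ 3) h3'
    obtain ⟨rfl, rfl⟩ := mul_eq_one.mp hkn
    norm_num
  · right
    have h9' : c ^ n = 3 ^ 2 := by exact_mod_cast h9
    obtain ⟨k, hk, rfl⟩ := (Nat.dvd_prime_pow Nat.prime_three).mp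
      ((dvd_pow_self c hn).trans (dvd_of_eq h9'))
    rw [← pow_mul] at h9'
    have hkn : k * n = 2 := Nat.pow_right_injective (by norm_num : 2 ≤ 3) h9'
    interval_cases k
    · omega
    · right
      obtain rfl : n = 2 := by omega
      norm_num
    · left
      obtain rfl : n = 1 := by omega
      norm_num

theorem seven_two_equation (c : ℕ) (hc : 0 < c) (hc3 : c ≠ 3) (hc9 : c ≠ 9) :
    (∀ x₁ y₁ z₁ x₂ y₂ z₂ : ℕ,
      0 < x₁ → 0 < y₁ → 0 < z₁ → 0 < x₂ → 0 < y₂ → 0 < z₂ →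
      7 ^ x₁ + 2 ^ y₁ = c ^ z₁ → 7 ^ x₂ + 2 ^ y₂ = c ^ z₂ →
      (x₁, y₁, z₁) = (x₂, y₂, z₂)) ∧
    (∀ x y z : ℕ, 0 < x → 0 < y → 0 < z →
      (7 ^ x + 2 ^ y = 3 ^ z ↔ (x, y, z) = (1, 1, 2) ∨ (x, y, z) = (2, 5, 4))) := by
  constructor
  · intro x₁ y₁ z₁ x₂ y₂ z₂ hx₁ hy₁ hz₁ hx₂ hy₂ hz₂ h₁ h₂
    obtain rfl : z₁ = 1 := by
      rcases exponent_eq_one_or hc hx₁ hy₁ hz₁ h₁ with h | h | h | h <;> omega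
    obtain rfl : z₂ = 1 := by
      rcases exponent_eq_one_or hc hx₂ hy₂ hz₂ h₂ with h | h | h | h <;> omega
    obtain ⟨rfl, rfl⟩ := eq_of_seven_pow_add_two_pow_eq hx₁ hy₁ hx₂ hy₂ (h₁.trans h₂.symm)
    rfl
  · intro x y z hx hy hz
    simp only [Prod.mk.injEq]
    constructor
    · intro h
      rcases exponent_eq_one_or (by norm_num) hx hy hz h with rfl | h' | h' | h'
      · have h1 : 7 ^ 1 ≤ 7 ^ x := Nat.pow_le_pow_right (by norm_num) hx
        have h2 : 0 < 2 ^ y := by positivity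
        omega
      · omega
      · omega
      · omega
    · rintro (⟨rfl, rfl, rfl⟩ | ⟨rfl, rfl, rfl⟩) <;> norm_num
end

section
/- Let a > 1 and b > 1 be coprime integers. For each prime p dividing a, let n_p be the least positive integer n such that p divides b^n − 1 or p divides b^n + 1, and set g_p = max(ν_p(b^{n_p} − 1), ν_p(b^{n_p} + 1)). If x and y are positive integers such that a^x divides b^y − 1 or a^x divides b^y + 1, then a^x divides y · ∏_{p prime, p ∣ a} p^{g_p}. (Equivalently, with S = (Σ_{p ∣ a} g_p·log p)/log a, the quantity a^{x−S} divides y.) -/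
/-- Lifting the exponent for `c ^ k - 1`, uniformly in the prime `p`. -/
theorem emultiplicity_pow_sub_one {p : ℕ} (hp : p.Prime) {c : ℤ} (hc : (p : ℤ) ∣ c - 1)
    (h4 : p = 2 → 4 ∣ c - 1) (k : ℕ) :
    emultiplicity (p : ℤ) (c ^ k - 1) = emultiplicity (p : ℤ) (c - 1) + emultiplicity p k := by
  have hpc : ¬(p : ℤ) ∣ c := fun h ↦
    (Nat.prime_iff_prime_int.mp hp).not_dvd_one ((dvd_sub_right h).mp hc)
  rcases hp.eq_two_or_odd' with rfl | hodd
  · have := Int.two_pow_sub_pow' (y := 1) k (h4 rfl) hpc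
    rw [one_pow] at this
    rw [← Int.natCast_emultiplicity 2 k]
    exact this
  · simpa using Int.emultiplicity_pow_sub_pow hp hodd hc hpc k

theorem four_dvd_sub_one_or_add_one {c : ℤ} (hc : (2 : ℤ) ∣ c - 1) : 4 ∣ c - 1 ∨ 4 ∣ c + 1 := by
  lia

theorem pow_dvd_mul_pow_of_dvd_pow_sub_unit {p g m k : ℕ} (hp : p.Prime) {c : ℤ}
    (hc : (p : ℤ) ∣ c - 1) (h4 : p = 2 → 4 ∣ c - 1)
    (hg : emultiplicity (p : ℤ) (c - 1) = g) (u : ℤˣ) (h : (p : ℤ) ^ m ∣ c ^ k - u) :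
    p ^ m ∣ k * p ^ g := by
  have hg1 : 1 ≤ g := by
    have := le_emultiplicity_of_pow_dvd (k := 1) (by simpa using hc)
    rw [hg] at this
    exact_mod_cast this
  rcases Int.units_eq_one_or u with rfl | rfl
  · apply pow_dvd_of_le_emultiplicity
    have := le_emultiplicity_of_pow_dvd h
    rw [Units.val_one, emultiplicity_pow_sub_one hp hc h4, hg] at this
    rw [emultiplicity_mul hp.prime, hp.emultiplicity_pow_self, add_comm]
    exact this
  · have hm : m ≤ 1 := by
      by_contra! hm
      have hsq := (pow_dvd_pow (p : ℤ) hm).trans h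
      have hck : c - 1 ∣ c ^ k - 1 := sub_one_dvd_pow_sub_one c k
      simp only [Units.val_neg, Units.val_one, sub_neg_eq_add] at hsq
      have h2 : (p : ℤ) ∣ 2 := by
        have := dvd_sub ((dvd_pow_self (p : ℤ) two_ne_zero).trans hsq) (hc.trans hck)
        ring_nf at this
        exact this
      obtain rfl : p = 2 := (Nat.prime_dvd_prime_iff_eq hp Nat.prime_two).mp (by exact_mod_cast h2)
      have := (h4 rfl).trans hck
      norm_num at hsq
      lia
    exact (pow_dvd_pow p (hm.trans hg1)).trans (dvd_mul_left _ _)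

/-- The least exponent `n` with `b ^ n ≡ ±1` divides every exponent `y` with `b ^ y ≡ ±1`. -/
theorem dvd_of_dvd_pow_sub_unit {d b : ℤ} {n y : ℕ} (hn : 0 < n) (t u : ℤˣ)
    (hmin : ∀ m : ℕ, 0 < m → ∀ v : ℤˣ, d ∣ b ^ m - v → n ≤ m)
    (ht : d ∣ b ^ n - t) (hu : d ∣ b ^ y - u) : n ∣ y := by
  by_contra hny
  have hr : 0 < y % n := Nat.pos_of_ne_zero fun h ↦ hny (Nat.dvd_of_mod_eq_zero h)
  refine (Nat.mod_lt y hn).not_ge (hmin _ hr ((t ^ (y / n))⁻¹ * u) ?_)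
  have hq : d ∣ (b ^ n) ^ (y / n) - (t : ℤ) ^ (y / n) := ht.trans (sub_dvd_pow_sub_pow _ _ _)
  have hy : b ^ y = (b ^ n) ^ (y / n) * b ^ (y % n) := by
    rw [← pow_mul, ← pow_add, Nat.div_add_mod]
  rw [← (t ^ (y / n)).isUnit.dvd_mul_left, mul_sub, ← Units.val_mul, mul_inv_cancel_left]
  have := dvd_sub hu (hq.mul_right (b ^ (y % n)))
  rw [hy] at this
  convert this using 1
  push_cast
  ring

theorem pow_dvd_mul_pow_of_minimal {p g m n y : ℕ} (hp : p.Prime) {b : ℤ} (hn : 0 < n)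
    (hmin : ∀ m : ℕ, 0 < m → ∀ v : ℤˣ, (p : ℤ) ∣ b ^ m - v → n ≤ m)
    (hdvd : ∃ v : ℤˣ, (p : ℤ) ∣ b ^ n - v)
    (hle : ∀ v : ℤˣ, emultiplicity (p : ℤ) (b ^ n - v) ≤ g)
    (hg : ∃ v : ℤˣ, emultiplicity (p : ℤ) (b ^ n - v) = g)
    (hm : m ≠ 0) (u : ℤˣ) (h : (p : ℤ) ^ m ∣ b ^ y - u) : p ^ m ∣ y * p ^ g := by
  obtain ⟨w, hw⟩ := hdvd
  obtain ⟨t, ht⟩ := hg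
  have hpow {j : ℕ} {v : ℤˣ} (hv : (p : ℤ) ^ j ∣ b ^ n - v) : (p : ℤ) ^ j ∣ b ^ n - t :=
    pow_dvd_of_le_emultiplicity <| (le_emultiplicity_of_pow_dvd hv).trans (ht ▸ hle v)
  have hpt : (p : ℤ) ∣ b ^ n - t := by simpa using hpow (j := 1) (by simpa using hw)
  obtain ⟨k, rfl⟩ := dvd_of_dvd_pow_sub_unit hn t u hmin hpt ((dvd_pow_self _ hm).trans h)
  have htt : (t : ℤ) * t = 1 := Int.units_coe_mul_self t
  have hc : (t : ℤ) * b ^ n - 1 = t * (b ^ n - t) := by rw [mul_sub, htt]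
  have h4 : p = 2 → (4 : ℤ) ∣ t * b ^ n - 1 := by
    rintro rfl
    have hodd : (2 : ℤ) ∣ b ^ n - 1 := by
      rcases Int.units_eq_one_or t with rfl | rfl
      · simpa using hpt
      · simp at hpt
        lia
    rw [hc]
    apply Dvd.dvd.mul_left
    have h42 : (4 : ℤ) = ((2 : ℕ) : ℤ) ^ 2 := by norm_num
    rw [h42]
    rcases four_dvd_sub_one_or_add_one hodd with h | h
    · exact hpow (v := 1) (by simpa using h)
    · exact hpow (v := -1) (by simpa using h)
  have key : p ^ m ∣ k * p ^ g := by
    refine pow_dvd_mul_pow_of_dvd_pow_sub_unit hp (c := t * b ^ n) (hc ▸ hpt.mul_left _) h4 ?_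
      (t ^ k * u) ?_
    · rw [hc, ← ht]
      exact emultiplicity_eq_of_associated_right (associated_unit_mul_left _ _ t.isUnit)
    · rw [mul_pow, ← pow_mul, Units.val_mul, Units.val_pow_eq_pow_val, ← mul_sub]
      exact h.mul_left _
  rw [mul_assoc]
  exact key.mul_left n

theorem exists_natCast_dvd_pow_sub_unit_iff {d b m : ℕ} (hb : 0 < b) :
    (∃ v : ℤˣ, (d : ℤ) ∣ (b : ℤ) ^ m - v) ↔ d ∣ b ^ m - 1 ∨ d ∣ b ^ m + 1 := by
  have h1 : 1 ≤ b ^ m := Nat.one_le_pow _ _ hb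
  rw [← Int.natCast_dvd_natCast, ← Int.natCast_dvd_natCast (n := b ^ m + 1), Nat.cast_sub h1]
  push_cast
  constructor
  · rintro ⟨v, hv⟩
    rcases Int.units_eq_one_or v with rfl | rfl
    · exact .inl (by simpa using hv)
    · exact .inr (by simpa using hv)
  · rintro (h | h)
    · exact ⟨1, by simpa using h⟩
    · exact ⟨-1, by simpa using h⟩

theorem proposition1_divisibility
    (a b : ℕ) (ha : 1 < a) (hb : 1 < b) (hab : Nat.Coprime a b)
    (n g : ℕ → ℕ)
    (hn : ∀ p ∈ a.primeFactors, 0 < n p ∧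
      (p ∣ b ^ (n p) - 1 ∨ p ∣ b ^ (n p) + 1) ∧
      ∀ m : ℕ, 0 < m → (p ∣ b ^ m - 1 ∨ p ∣ b ^ m + 1) → n p ≤ m)
    (hg : ∀ p ∈ a.primeFactors,
      g p = max (padicValNat p (b ^ (n p) - 1)) (padicValNat p (b ^ (n p) + 1)))
    (x y : ℕ) (hx : 0 < x) (hy : 0 < y)
    (hdvd : a ^ x ∣ b ^ y - 1 ∨ a ^ x ∣ b ^ y + 1) :
    a ^ x ∣ y * ∏ p ∈ a.primeFactors, p ^ g p := by
  have hb0 : 0 < b := by lia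
  rw [Nat.dvd_iff_prime_pow_dvd_dvd]
  intro p m hp hpm
  rcases eq_or_ne m 0 with rfl | hm
  · simp
  have hpa : p ∈ a.primeFactors :=
    Nat.mem_primeFactors.mpr
      ⟨hp, hp.dvd_of_dvd_pow ((dvd_pow_self p hm).trans hpm), by lia⟩
  obtain ⟨hn0, hnd, hmin⟩ := hn p hpa
  have : Fact p.Prime := ⟨hp⟩
  have hone : 1 < b ^ n p := Nat.one_lt_pow hn0.ne' hb
  have hsub : emultiplicity (p : ℤ) ((b : ℤ) ^ n p - (1 : ℤˣ)) =
      padicValNat p (b ^ n p - 1) := by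
    rw [padicValNat_eq_emultiplicity (by lia), ← Int.natCast_emultiplicity, Nat.cast_sub hone.le]
    simp
  have hadd : emultiplicity (p : ℤ) ((b : ℤ) ^ n p - (-1 : ℤˣ)) =
      padicValNat p (b ^ n p + 1) := by
    rw [padicValNat_eq_emultiplicity (by lia), ← Int.natCast_emultiplicity]
    simp
  obtain ⟨u, hu⟩ := (exists_natCast_dvd_pow_sub_unit_iff (d := p ^ m) (m := y) hb0).mpr
    (hdvd.imp hpm.trans hpm.trans)
  refine (pow_dvd_mul_pow_of_minimal (g := g p) (b := b) hp hn0
    (fun k hk v hv ↦ hmin k hk ((exists_natCast_dvd_pow_sub_unit_iff hb0).mp ⟨v, hv⟩))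
    ((exists_natCast_dvd_pow_sub_unit_iff hb0).mpr hnd) (fun v ↦ ?_) ?_ hm u
    (by exact_mod_cast hu)).trans (mul_dvd_mul_left y (Finset.dvd_prod_of_mem _ hpa))
  · rcases Int.units_eq_one_or v with rfl | rfl
    · rw [hsub, hg p hpa]
      exact_mod_cast le_max_left _ _
    · rw [hadd, hg p hpa]
      exact_mod_cast le_max_right _ _
  · rw [hg p hpa]
    rcases max_choice (padicValNat p (b ^ n p - 1)) (padicValNat p (b ^ n p + 1)) with h | h
    · exact ⟨1, by rw [h, hsub]⟩
    · exact ⟨-1, by rw [h, hadd]⟩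
end

section
/- Let a > 2 and b > 1 be coprime integers with (a,b) ≠ (3,2). For each prime p dividing a, let n_p be the least positive integer n such that p divides b^n − 1 or p divides b^n + 1, and set g_p = max(ν_p(b^{n_p} − 1), ν_p(b^{n_p} + 1)). Then (∏_{p prime, p ∣ a} p^{g_p})² < b^a. (Equivalently, S < a·log(b)/(2·log(a)), where S = (Σ_{p ∣ a} g_p·log p)/log a.) -/
theorem sum_primeFactors_le {a : ℕ} (ha : 1 < a) :
    ∑ p ∈ a.primeFactors, p ≤ a ∧ (¬ a.Prime → ∑ p ∈ a.primeFactors, p < a) := by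
  induction a using Nat.recOnPosPrimePosCoprime with
  | zero => omega
  | one => omega
  | prime_pow p k hp hk =>
    rw [Nat.primeFactors_prime_pow hk.ne' hp, Finset.sum_singleton]
    refine ⟨Nat.le_self_pow hk.ne' p, fun h => ?_⟩
    have hk1 : k ≠ 1 := by
      rintro rfl
      exact h (by simpa using hp)
    exact lt_self_pow₀ hp.one_lt (by omega)
  | coprime x y hx hy hxy ihx ihy =>
    have hlt : ∑ p ∈ (x * y).primeFactors, p < x * y := by
      rw [hxy.primeFactors_mul, Finset.sum_union hxy.disjoint_primeFactors]
      have h1 := (ihx hx).1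
      have h2 := (ihy hy).1
      have hne : x ≠ y := by
        rintro rfl
        rw [Nat.coprime_self] at hxy
        omega
      rcases lt_or_gt_of_ne hne with h | h <;> nlinarith
    exact ⟨hlt.le, fun _ => hlt⟩

theorem pow_padicValNat_le_pow_add_one (p : ℕ) {b : ℕ} (hb : 1 < b) {n : ℕ} (hn : 0 < n) :
    p ^ max (padicValNat p (b ^ n - 1)) (padicValNat p (b ^ n + 1)) ≤ b ^ n + 1 := by
  have hbn : 1 < b ^ n := Nat.one_lt_pow hn.ne' hb
  rcases max_choice (padicValNat p (b ^ n - 1)) (padicValNat p (b ^ n + 1)) with h | h <;> rw [h]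
  · exact (Nat.le_of_dvd (by omega) pow_padicValNat_dvd).trans (by omega)
  · exact Nat.le_of_dvd (by omega) pow_padicValNat_dvd

theorem dvd_pow_half_sub_one_or_add_one {p b : ℕ} (hp : p.Prime) (hpb : ¬ p ∣ b) :
    p ∣ b ^ (p / 2) - 1 ∨ p ∣ b ^ (p / 2) + 1 := by
  have : Fact p.Prime := ⟨hp⟩
  have hb0 : 0 < b := Nat.pos_of_ne_zero (by rintro rfl; simp at hpb)
  have hb : (b : ZMod p) ≠ 0 := by rwa [Ne, ZMod.natCast_eq_zero_iff]
  rcases ZMod.pow_div_two_eq_neg_one_or_one p hb with h | h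
  · left
    rw [← ZMod.natCast_eq_zero_iff, Nat.cast_sub (Nat.one_le_pow _ _ hb0)]
    simp [h]
  · right
    rw [← ZMod.natCast_eq_zero_iff]
    simp [h]

theorem sq_pow_padicValNat_lt {p b n : ℕ} (hp : p.Prime) (hpb : ¬ p ∣ b) (hb : 1 < b)
    (hn : 0 < n)
    (hmin : ∀ m : ℕ, 0 < m → (p ∣ b ^ m - 1 ∨ p ∣ b ^ m + 1) → n ≤ m) :
    (p ^ max (padicValNat p (b ^ n - 1)) (padicValNat p (b ^ n + 1))) ^ 2 <
      b ^ (p + if p = (if b = 2 then 3 else 2) then 1 else 0) := by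
  have hp2 := hp.two_le
  have hnm : n ≤ p / 2 := hmin _ (by omega) (dvd_pow_half_sub_one_or_add_one hp hpb)
  have hle := (pow_padicValNat_le_pow_add_one p hb hn).trans
    (Nat.add_le_add_right (Nat.pow_le_pow_right (by omega) hnm) 1)
  refine (Nat.pow_le_pow_left hle 2).trans_lt ?_
  rcases hp.eq_two_or_odd with rfl | hodd
  · have hb3 : 3 ≤ b := by omega
    rw [if_neg (by omega : b ≠ 2), if_pos rfl]
    norm_num
    nlinarith
  · by_cases h3 : p = 3 ∧ b = 2
    · obtain ⟨rfl, rfl⟩ := h3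
      norm_num
    · have hx : 3 ≤ b ^ (p / 2) := by
        by_cases hb2 : b = 2
        · subst hb2
          have : 2 ^ 2 ≤ 2 ^ (p / 2) := Nat.pow_le_pow_right (by omega) (by omega)
          omega
        · exact (by omega : 3 ≤ b).trans (Nat.le_self_pow (by omega) b)
      have hpow : b ^ p = (b ^ (p / 2)) ^ 2 * b := by
        rw [← pow_mul, ← pow_succ]
        congr 1
        omega
      refine lt_of_lt_of_le ?_ (Nat.pow_le_pow_right (by omega) (Nat.le_add_right p _))
      rw [hpow]
      nlinarith [Nat.mul_le_mul_left ((b ^ (p / 2)) ^ 2) hb]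

theorem proposition2_bound
    (a b : ℕ) (ha : 2 < a) (hb : 1 < b) (hab : Nat.Coprime a b)
    (hne : (a, b) ≠ (3, 2))
    (n g : ℕ → ℕ)
    (hn : ∀ p ∈ a.primeFactors, 0 < n p ∧
      (p ∣ b ^ (n p) - 1 ∨ p ∣ b ^ (n p) + 1) ∧
      ∀ m : ℕ, 0 < m → (p ∣ b ^ m - 1 ∨ p ∣ b ^ m + 1) → n p ≤ m)
    (hg : ∀ p ∈ a.primeFactors,
      g p = max (padicValNat p (b ^ (n p) - 1)) (padicValNat p (b ^ (n p) + 1))) :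
    (∏ p ∈ a.primeFactors, p ^ g p) ^ 2 < b ^ a := by
  rw [← Finset.prod_pow]
  have hlt : ∏ p ∈ a.primeFactors, (p ^ g p) ^ 2 <
      ∏ p ∈ a.primeFactors, b ^ (p + if p = (if b = 2 then 3 else 2) then 1 else 0) := by
    refine Finset.prod_lt_prod_of_nonempty (fun p hp => ?_) (fun p hp => ?_)
      (Nat.nonempty_primeFactors.2 (by omega))
    · have := (Nat.prime_of_mem_primeFactors hp).pos
      positivity
    · have hpp := Nat.prime_of_mem_primeFactors hp
      rw [hg p hp]
      refine sq_pow_padicValNat_lt hpp (fun h => ?_) hb (hn p hp).1 (hn p hp).2.2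
      exact Nat.not_coprime_of_dvd_of_dvd hpp.one_lt (Nat.dvd_of_mem_primeFactors hp) h hab
  refine hlt.trans_le ?_
  rw [Finset.prod_pow_eq_pow_sum, Finset.sum_add_distrib, Finset.sum_ite_eq']
  refine Nat.pow_le_pow_right (by omega) ?_
  obtain ⟨hle, hstrict⟩ := sum_primeFactors_le (a := a) (by omega)
  by_cases hap : a.Prime
  · rw [if_neg]
    · simpa using hle
    · rw [hap.primeFactors, Finset.mem_singleton]
      split_ifs with hb2
      · rintro rfl
        exact hne (by rw [hb2])
      · omega
  · have := hstrict hap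
    split_ifs <;> omega
end
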